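/- Let p ≥ 2, γ ∈ ℝ, and let u ∈ W̃_β^{2p+1,∞}. Then: (i) there exists a unique function ω in the space Ũ_T (continuous on [a,b], ω(a) = 0, ω|τᵢ ∈ Sᵢ for all i) such that β(g_{i,j}) ω′(g_{i,j}) = β(g_{i,j}) (u − I_h u)′(g_{i,j}) − γ (u − I_h u)(g_{i,j}) for all 1 ≤ i ≤ N and 1 ≤ j ≤ p; and (ii) there is a constant C, depending only on p, β⁻, β⁺, γ and b−a, such that sup_{x ∈ [a,b]} |ω(x)| ≤ C h^{p+2} ‖u‖_{2p+1,∞}. -/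

import Mathlib

open Set

/-- The piecewise-constant diffusion coefficient with interface point `α`. -/
noncomputable def betaPW (βm βp α : ℝ) : ℝ → ℝ := fun t => if t < α then βm else βp

/-- Membership in `W̃_β^{m,∞}`: continuous on `[a,b]`, zero boundary values, `C^m` on each
of `[a,α]` and `[α,b]`, and satisfying the flux jump conditions at `α` for `j = 1,…,m`. -/
def MemW (m : ℕ) (a b α βm βp : ℝ) (u : ℝ → ℝ) : Prop :=
  ContinuousOn u (Set.Icc a b) ∧ u a = 0 ∧ u b = 0 ∧
  ContDiffOn ℝ (m : ℕ∞) u (Set.Icc a α) ∧ ContDiffOn ℝ (m : ℕ∞) u (Set.Icc α b) ∧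
  ∀ j, 1 ≤ j → j ≤ m →
    βm * iteratedDerivWithin j u (Set.Icc a α) α
      = βp * iteratedDerivWithin j u (Set.Icc α b) α

/-- The broken `W^{m,∞}` norm `‖u‖_{m,∞}`: maximum of the piecewise `W^{m,∞}` norms on
`[a,α]` and `[α,b]`. -/
noncomputable def wnorm (m : ℕ) (a b α : ℝ) (u : ℝ → ℝ) : ℝ :=
  max (sSup {y : ℝ | ∃ j ≤ m, ∃ t ∈ Set.Icc a α,
        y = |iteratedDerivWithin j u (Set.Icc a α) t|})
      (sSup {y : ℝ | ∃ j ≤ m, ∃ t ∈ Set.Icc α b,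
        y = |iteratedDerivWithin j u (Set.Icc α b) t|})

/-- The special corrector function `ω ∈ Ũ_T` of (4.3): continuous on `[a,b]`, `ω(a) = 0`,
piecewise in the local immersed spaces `Sᵢ`, and with flux values at the generalized Gauss
points prescribed by `β ω′(g) = β (u − I_h u)′(g) − γ (u − I_h u)(g)`. -/
def OmegaProp (p N k : ℕ) (a b α βm βp γ : ℝ) (x : ℕ → ℝ) (g : ℕ → ℕ → ℝ)
    (u Ihu ω : ℝ → ℝ) : Prop :=
  ContinuousOn ω (Set.Icc a b) ∧ ω a = 0 ∧
  (∀ i, 1 ≤ i → i ≤ N → i ≠ k → ∃ q : Polynomial ℝ, q.natDegree ≤ p ∧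
    ∀ y ∈ Set.Icc (x (i - 1)) (x i), ω y = q.eval y) ∧
  (∃ qm qp : Polynomial ℝ, qm.natDegree ≤ p ∧ qp.natDegree ≤ p ∧
    (∀ y ∈ Set.Icc (x (k - 1)) α, ω y = qm.eval y) ∧
    (∀ y ∈ Set.Icc α (x k), ω y = qp.eval y) ∧
    ∀ j, 1 ≤ j → j ≤ p →
      βm * ((⇑Polynomial.derivative)^[j] qm).eval α
        = βp * ((⇑Polynomial.derivative)^[j] qp).eval α) ∧
  ∀ i ∈ Finset.Icc 1 N, ∀ j ∈ Finset.Icc 1 p,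
    betaPW βm βp α (g i j) * deriv ω (g i j)
      = betaPW βm βp α (g i j) * (deriv u (g i j) - deriv Ihu (g i j))
        - γ * (u (g i j) - Ihu (g i j))

section

open MeasureTheory Polynomial

theorem exists_derivative_eq (q : ℝ[X]) {n : ℕ} (hq : q.natDegree ≤ n) :
    ∃ P : ℝ[X], derivative P = q ∧ P.natDegree ≤ n + 1 := by
  refine ⟨∑ i ∈ Finset.range (n + 1), C (q.coeff i / (i + 1)) * X ^ (i + 1), ?_, ?_⟩
  · conv_rhs => rw [q.as_sum_range_C_mul_X_pow' (Nat.lt_succ_of_le hq)]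
    rw [derivative_sum]
    refine Finset.sum_congr rfl fun i _ => ?_
    rw [derivative_C_mul_X_pow, Nat.add_sub_cancel]
    congr 2
    push_cast
    have : (i : ℝ) + 1 ≠ 0 := by positivity
    field_simp
  · refine natDegree_sum_le_of_forall_le _ _ fun i hi => ?_
    refine (natDegree_C_mul_X_pow_le _ _).trans ?_
    have := Finset.mem_range.1 hi
    omega

/-- The Taylor polynomial with `n` terms at `c` built from a sequence `f` of successive
derivatives. -/
noncomputable def taylorSeqPoly (f : ℕ → ℝ → ℝ) (c : ℝ) (n : ℕ) : ℝ[X] :=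
  ∑ j ∈ Finset.range n, C (f j c / j.factorial) * (X - C c) ^ j

theorem natDegree_taylorSeqPoly_le (f : ℕ → ℝ → ℝ) (c : ℝ) (n : ℕ) :
    (taylorSeqPoly f c n).natDegree ≤ n - 1 := by
  refine natDegree_sum_le_of_forall_le _ _ fun i hi => ?_
  refine (natDegree_C_mul_le _ _).trans ?_
  refine natDegree_pow_le.trans ?_
  have := Finset.mem_range.1 hi
  rw [natDegree_X_sub_C]
  omega

theorem derivative_taylorSeqPoly_succ (f : ℕ → ℝ → ℝ) (c : ℝ) (n : ℕ) :
    derivative (taylorSeqPoly f c (n + 1)) = taylorSeqPoly (fun j => f (j + 1)) c n := by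
  rw [taylorSeqPoly, Finset.sum_range_succ', derivative_add, derivative_sum, taylorSeqPoly]
  simp only [pow_zero, mul_one, derivative_C, add_zero]
  refine Finset.sum_congr rfl fun i _ => ?_
  rw [derivative_C_mul, derivative_X_sub_C_pow, ← mul_assoc, Nat.add_sub_cancel, ← C_mul]
  congr 2
  rw [Nat.factorial_succ]
  push_cast
  have : (i : ℝ) + 1 ≠ 0 := by positivity
  have : (i.factorial : ℝ) ≠ 0 := by positivity
  field_simp

theorem eval_taylorSeqPoly_succ_self (f : ℕ → ℝ → ℝ) (c : ℝ) (n : ℕ) :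
    (taylorSeqPoly f c (n + 1)).eval c = f 0 c := by
  rw [taylorSeqPoly, Finset.sum_range_succ', eval_add, eval_finsetSum]
  simp

theorem abs_sub_eval_taylorSeqPoly_le {s : Set ℝ} (hs : Convex ℝ s) {c M : ℝ} (hc : c ∈ s)
    (n : ℕ) : ∀ f : ℕ → ℝ → ℝ,
    (∀ j < n, ∀ t ∈ s, HasDerivWithinAt (f j) (f (j + 1) t) s t) →
    (∀ t ∈ s, |f n t| ≤ M) →
    ∀ t ∈ s, |f 0 t - (taylorSeqPoly f c n).eval t| ≤ M * |t - c| ^ n := by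
  induction n with
  | zero =>
    intro f _ hM t ht
    simpa [taylorSeqPoly] using hM t ht
  | succ n ih =>
    intro f hf hM t ht
    have key := ih (fun j => f (j + 1)) (fun j hj => hf (j + 1) (by omega)) hM
    have hsub : uIcc c t ⊆ s := by
      rw [← segment_eq_uIcc]
      exact hs.segment_subset hc ht
    have hM0 : 0 ≤ M := (abs_nonneg _).trans (hM c hc)
    have := (convex_uIcc c t).norm_image_sub_le_of_norm_hasDerivWithin_le
      (f := fun y => f 0 y - (taylorSeqPoly f c (n + 1)).eval y)
      (f' := fun y => f 1 y - (taylorSeqPoly (fun j => f (j + 1)) c n).eval y)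
      (C := M * |t - c| ^ n)
      (fun y hy => by
        refine ((hf 0 (by omega) y (hsub hy)).mono hsub).sub ?_
        rw [← derivative_taylorSeqPoly_succ]
        exact (Polynomial.hasDerivAt _ _).hasDerivWithinAt)
      (fun y hy => by
        rw [Real.norm_eq_abs]
        refine (key y (hsub hy)).trans ?_
        have : |y - c| ≤ |t - c| := abs_sub_left_of_mem_uIcc hy
        gcongr)
      left_mem_uIcc right_mem_uIcc
    rw [eval_taylorSeqPoly_succ_self, sub_self, sub_zero, Real.norm_eq_abs,
      Real.norm_eq_abs] at this
    rw [pow_succ, ← mul_assoc]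
    exact this

theorem sq_integral_mul_le {l r : ℝ} (hlr : l < r) {w f : ℝ → ℝ}
    (hw : IntervalIntegrable w volume l r) (hw0 : ∀ t, 0 < w t)
    (hf : ContinuousOn f (Icc l r)) :
    (∫ t in l..r, f t * w t) ^ 2
      ≤ (∫ t in l..r, w t) * ∫ t in l..r, f t ^ 2 * w t := by
  have hI : 0 < ∫ t in l..r, w t :=
    intervalIntegral.intervalIntegral_pos_of_pos hw hw0 hlr
  have hf' : ContinuousOn f (uIcc l r) := by rwa [uIcc_of_le hlr.le]
  set I := ∫ t in l..r, w t
  set J := ∫ t in l..r, f t * w t with hJ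
  set S := ∫ t in l..r, f t ^ 2 * w t with hS
  have i1 : IntervalIntegrable (fun t => f t * w t) volume l r := hw.continuousOn_mul hf'
  have i2 : IntervalIntegrable (fun t => f t ^ 2 * w t) volume l r :=
    hw.continuousOn_mul (hf'.pow 2)
  have h0 : 0 ≤ ∫ t in l..r, (f t - J / I) ^ 2 * w t :=
    intervalIntegral.integral_nonneg hlr.le
      fun t _ => mul_nonneg (sq_nonneg _) (hw0 t).le
  have h1 : ∫ t in l..r, (f t - J / I) ^ 2 * w t = S - 2 * (J / I) * J + (J / I) ^ 2 * I := by
    rw [hS, hJ, ← intervalIntegral.integral_const_mul, ← intervalIntegral.integral_const_mul,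
      ← intervalIntegral.integral_sub i2 (i1.const_mul _),
      ← intervalIntegral.integral_add (i2.sub (i1.const_mul _)) (hw.const_mul _)]
    congr 1
    ext t
    ring
  rw [h1] at h0
  have h2 : S - 2 * (J / I) * J + (J / I) ^ 2 * I = S - J ^ 2 / I := by
    field_simp
    ring
  rw [h2, sub_nonneg, div_le_iff₀ hI] at h0
  linarith

theorem le_mul_of_sq_le_of_le_mul {n I S ρ : ℝ} (hI : 0 ≤ I) (hρ : 0 ≤ ρ) (hn : 0 ≤ n)
    (h1 : n ^ 2 ≤ I * S) (h2 : S ≤ ρ * n) : n ≤ I * ρ := by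
  rcases hn.eq_or_lt with rfl | hn
  · positivity
  · have : n * n ≤ (I * ρ) * n := by nlinarith [mul_le_mul_of_nonneg_left h2 hI]
    exact le_of_mul_le_mul_right this hn

theorem abs_integral_mul_le {l r : ℝ} (hlr : l ≤ r) {w f : ℝ → ℝ}
    (hw : IntervalIntegrable w volume l r) (hw0 : ∀ t, 0 < w t) {K : ℝ}
    (hf : ContinuousOn f (Icc l r)) (hK : ∀ t ∈ Icc l r, |f t| ≤ K) {h : ℝ → ℝ}
    (hh : ContinuousOn h (Icc l r)) :
    |∫ t in l..r, f t * h t * w t| ≤ K * ∫ t in l..r, |h t| * w t := by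
  have hf' : ContinuousOn f (uIcc l r) := by rwa [uIcc_of_le hlr]
  have hh' : ContinuousOn h (uIcc l r) := by rwa [uIcc_of_le hlr]
  rw [← intervalIntegral.integral_const_mul]
  refine (intervalIntegral.abs_integral_le_integral_abs hlr).trans ?_
  refine intervalIntegral.integral_mono_on hlr
    (hw.continuousOn_mul (hf'.mul hh')).abs
    ((hw.continuousOn_mul hh'.abs).const_mul _) fun t ht => ?_
  rw [abs_mul, abs_mul, abs_of_pos (hw0 t), mul_assoc]
  exact mul_le_mul_of_nonneg_right (hK t ht) (mul_nonneg (abs_nonneg _) (hw0 t).le)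

theorem abs_integral_le_integral_abs_mul {l r t : ℝ} (ht : t ∈ Icc l r) {w f : ℝ → ℝ}
    (hw : IntervalIntegrable w volume l r) (hw0 : ∀ t, 0 < w t)
    (hf : ContinuousOn f (Icc l r)) :
    |∫ s in l..t, f s * w s| ≤ ∫ s in l..r, |f s| * w s := by
  have hfc : ContinuousOn f (uIcc l r) := by rwa [uIcc_of_le (ht.1.trans ht.2)]
  refine (intervalIntegral.abs_integral_le_integral_abs ht.1).trans ?_
  have : (fun s => |f s * w s|) = fun s => |f s| * w s := by
    ext s
    rw [abs_mul, abs_of_pos (hw0 s)]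
  rw [this]
  exact intervalIntegral.integral_mono_interval le_rfl ht.1 ht.2
    (ae_of_all _ fun s => mul_nonneg (abs_nonneg _) (hw0 s).le)
    (hw.continuousOn_mul hfc.abs)

/-- The data attached to one mesh element `[l, r]`: the weight `w = 1/β`, the quadrature rule,
the flux `Φ` of the function `u`, the flux `ψ` of its projection, the projection error `e` and
the flux `χ` of the corrector. -/
structure IsElementData (p : ℕ) (l r γ : ℝ) (w Φ e : ℝ → ℝ) (g A : ℕ → ℝ)
    (ψ χ : ℝ[X]) : Prop where
  one_le : 1 ≤ p
  lt : l < r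
  weight_int : IntervalIntegrable w volume l r
  weight_pos : ∀ t, 0 < w t
  node_mem : ∀ j ∈ Finset.Icc 1 p, g j ∈ Icc l r
  coeff_pos : ∀ j ∈ Finset.Icc 1 p, 0 < A j
  quad : ∀ F : ℝ[X], F.natDegree ≤ 2 * p - 1 →
    ∑ j ∈ Finset.Icc 1 p, A j * F.eval (g j) = ∫ t in l..r, F.eval t * w t
  flux_cont : ContinuousOn Φ (Icc l r)
  proj_deg : ψ.natDegree ≤ p - 1
  corr_deg : χ.natDegree ≤ p - 1
  orth : ∀ q : ℝ[X], q.natDegree ≤ p - 1 →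
    ∫ t in l..r, (Φ t - ψ.eval t) * q.eval t * w t = 0
  err_cont : ContinuousOn e (Icc l r)
  err_eq : ∀ t ∈ Icc l r, e t = ∫ s in l..t, (Φ s - ψ.eval s) * w s
  corr_eq : ∀ j ∈ Finset.Icc 1 p, χ.eval (g j) = Φ (g j) - ψ.eval (g j) - γ * e (g j)

namespace IsElementData

variable {p : ℕ} {l r γ : ℝ} {w Φ e : ℝ → ℝ} {g A : ℕ → ℝ} {ψ χ : ℝ[X]}

theorem sum_coeff (H : IsElementData p l r γ w Φ e g A ψ χ) :
    ∑ j ∈ Finset.Icc 1 p, A j = ∫ t in l..r, w t := by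
  simpa using H.quad 1 (by simp)

theorem weight_integral_pos (H : IsElementData p l r γ w Φ e g A ψ χ) :
    0 < ∫ t in l..r, w t :=
  intervalIntegral.intervalIntegral_pos_of_pos H.weight_int H.weight_pos H.lt

theorem continuousOn_sub_eval (H : IsElementData p l r γ w Φ e g A ψ χ) (T : ℝ[X]) :
    ContinuousOn (fun t => Φ t - T.eval t) (Icc l r) :=
  H.flux_cont.sub T.continuous.continuousOn

theorem abs_quad_le (H : IsElementData p l r γ w Φ e g A ψ χ) {F h : ℝ → ℝ} {ρ : ℝ}
    (hF : ∀ t ∈ Icc l r, |F t| ≤ ρ * |h t|) :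
    |∑ j ∈ Finset.Icc 1 p, A j * F (g j)| ≤ ρ * ∑ j ∈ Finset.Icc 1 p, A j * |h (g j)| := by
  rw [Finset.mul_sum]
  refine (Finset.abs_sum_le_sum_abs _ _).trans (Finset.sum_le_sum fun j hj => ?_)
  rw [abs_mul, abs_of_pos (H.coeff_pos j hj)]
  have := mul_le_mul_of_nonneg_left (hF _ (H.node_mem j hj)) (H.coeff_pos j hj).le
  linarith

theorem abs_quad_le_of_integral_eq_zero (H : IsElementData p l r γ w Φ e g A ψ χ)
    {F h : ℝ → ℝ} {ρ : ℝ} {T : ℝ[X]} (hFc : ContinuousOn F (Icc l r))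
    (hhc : ContinuousOn h (Icc l r)) (hT : T.natDegree ≤ 2 * p - 1)
    (hFT : ∀ t ∈ Icc l r, |F t - T.eval t| ≤ ρ * |h t|)
    (hF : ∫ t in l..r, F t * w t = 0) :
    |∑ j ∈ Finset.Icc 1 p, A j * F (g j)|
      ≤ ρ * ((∫ t in l..r, |h t| * w t) + ∑ j ∈ Finset.Icc 1 p, A j * |h (g j)|) := by
  have hle := H.lt.le
  have hF' : ContinuousOn F (uIcc l r) := by rwa [uIcc_of_le hle]
  have hh' : ContinuousOn h (uIcc l r) := by rwa [uIcc_of_le hle]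
  have hsplit : ∑ j ∈ Finset.Icc 1 p, A j * F (g j)
      = ∑ j ∈ Finset.Icc 1 p, A j * (F (g j) - T.eval (g j))
        - ∫ t in l..r, (F t - T.eval t) * w t := by
    have h1 : ∫ t in l..r, (F t - T.eval t) * w t = 0 - ∫ t in l..r, T.eval t * w t := by
      rw [← hF, ← intervalIntegral.integral_sub (H.weight_int.continuousOn_mul hF')
        (H.weight_int.continuousOn_mul T.continuous.continuousOn)]
      congr 1
      ext t
      ring
    rw [h1, ← H.quad T hT, zero_sub, sub_neg_eq_add, ← Finset.sum_add_distrib]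
    refine Finset.sum_congr rfl fun j _ => ?_
    ring
  have h2 : |∫ t in l..r, (F t - T.eval t) * w t| ≤ ρ * ∫ t in l..r, |h t| * w t := by
    rw [← intervalIntegral.integral_const_mul]
    refine (intervalIntegral.abs_integral_le_integral_abs hle).trans ?_
    refine intervalIntegral.integral_mono_on hle
      (H.weight_int.continuousOn_mul (hF'.sub T.continuous.continuousOn)).abs
      ((H.weight_int.continuousOn_mul hh'.abs).const_mul _) fun t ht => ?_
    rw [abs_mul, abs_of_pos (H.weight_pos t), ← mul_assoc]
    exact mul_le_mul_of_nonneg_right (hFT t ht) (H.weight_pos t).le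
  have h3 := H.abs_quad_le (F := fun t => F t - T.eval t) hFT
  rw [hsplit]
  refine (abs_sub _ _).trans ?_
  linarith

theorem abs_quad_le_const_of_integral_eq_zero (H : IsElementData p l r γ w Φ e g A ψ χ)
    {F : ℝ → ℝ} {ρ : ℝ} {T : ℝ[X]} (hFc : ContinuousOn F (Icc l r))
    (hT : T.natDegree ≤ 2 * p - 1)
    (hFT : ∀ t ∈ Icc l r, |F t - T.eval t| ≤ ρ)
    (hF : ∫ t in l..r, F t * w t = 0) :
    |∑ j ∈ Finset.Icc 1 p, A j * F (g j)| ≤ 2 * ρ * ∫ t in l..r, w t := by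
  have := H.abs_quad_le_of_integral_eq_zero (h := fun _ => 1) hFc continuousOn_const hT
    (ρ := ρ) (by simpa using hFT) hF
  simp only [abs_one, one_mul, mul_one, H.sum_coeff] at this
  linarith

theorem abs_err_le (H : IsElementData p l r γ w Φ e g A ψ χ) {ρ : ℝ} {T : ℝ[X]}
    (hT : T.natDegree ≤ p - 1) (hΦT : ∀ t ∈ Icc l r, |Φ t - T.eval t| ≤ ρ) :
    ∀ t ∈ Icc l r, |e t| ≤ (∫ t in l..r, w t) * ρ := by
  have hle := H.lt.le
  have hEc := H.continuousOn_sub_eval ψ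
  have hEc' : ContinuousOn (fun t => Φ t - ψ.eval t) (uIcc l r) := by rwa [uIcc_of_le hle]
  have hRc := H.continuousOn_sub_eval T
  have hRc' : ContinuousOn (fun t => Φ t - T.eval t) (uIcc l r) := by rwa [uIcc_of_le hle]
  have hS : ∫ t in l..r, (Φ t - ψ.eval t) ^ 2 * w t
      = ∫ t in l..r, (Φ t - T.eval t) * (Φ t - ψ.eval t) * w t := by
    have h0 := H.orth (T - ψ) ((natDegree_sub_le _ _).trans (max_le hT H.proj_deg))
    have i1 : IntervalIntegrable (fun t => (Φ t - ψ.eval t) ^ 2 * w t) volume l r :=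
      H.weight_int.continuousOn_mul (hEc'.pow 2)
    have i2 : IntervalIntegrable (fun t => (Φ t - T.eval t) * (Φ t - ψ.eval t) * w t)
        volume l r := H.weight_int.continuousOn_mul (hRc'.mul hEc')
    rw [← sub_eq_zero, ← h0, ← intervalIntegral.integral_sub i1 i2]
    congr 1
    ext t
    rw [eval_sub]
    ring
  have hρ : 0 ≤ ρ := (abs_nonneg _).trans (hΦT l (left_mem_Icc.2 hle))
  have hn : 0 ≤ ∫ t in l..r, |Φ t - ψ.eval t| * w t :=
    intervalIntegral.integral_nonneg hle
      fun t _ => mul_nonneg (abs_nonneg _) (H.weight_pos t).le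
  have h1 := sq_integral_mul_le H.lt H.weight_int H.weight_pos hEc.abs
  simp only [sq_abs] at h1
  have h2 := (le_abs_self _).trans
    (abs_integral_mul_le hle H.weight_int H.weight_pos hRc hΦT hEc)
  rw [← hS] at h2
  intro t ht
  rw [H.err_eq t ht]
  exact (abs_integral_le_integral_abs_mul ht H.weight_int H.weight_pos hEc).trans
    (le_mul_of_sq_le_of_le_mul H.weight_integral_pos.le hρ hn h1 h2)

theorem integral_abs_corr_le (H : IsElementData p l r γ w Φ e g A ψ χ) {ρ ε : ℝ} {T : ℝ[X]}
    (hT : T.natDegree ≤ p) (hΦT : ∀ t ∈ Icc l r, |Φ t - T.eval t| ≤ ρ)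
    (he : ∀ t ∈ Icc l r, |e t| ≤ ε) :
    ∫ t in l..r, |χ.eval t| * w t ≤ (∫ t in l..r, w t) * (2 * ρ + |γ| * ε) := by
  have hle := H.lt.le
  have hp := H.one_le
  have hψ := H.proj_deg
  have hχ := H.corr_deg
  have hχc : ContinuousOn (fun t => χ.eval t) (Icc l r) := χ.continuous.continuousOn
  have hI := H.weight_integral_pos
  have hρ : 0 ≤ ρ := (abs_nonneg _).trans (hΦT l (left_mem_Icc.2 hle))
  have hε : 0 ≤ ε := (abs_nonneg _).trans (he l (left_mem_Icc.2 hle))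
  set I := ∫ t in l..r, w t
  set n₁ := ∫ t in l..r, |χ.eval t| * w t
  set n₂ := ∑ j ∈ Finset.Icc 1 p, A j * |χ.eval (g j)| with hn₂
  have hn₁0 : 0 ≤ n₁ := intervalIntegral.integral_nonneg hle
    fun t _ => mul_nonneg (abs_nonneg _) (H.weight_pos t).le
  set S := ∫ t in l..r, χ.eval t ^ 2 * w t with hS
  have hSq : ∑ j ∈ Finset.Icc 1 p, A j * χ.eval (g j) ^ 2 = S := by
    have := H.quad (χ ^ 2) (natDegree_pow_le.trans (by omega))
    simpa only [eval_pow] using this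
  have h1 : n₁ ^ 2 ≤ I * S := by
    have := sq_integral_mul_le H.lt H.weight_int H.weight_pos hχc.abs
    simpa only [sq_abs] using this
  have h2 : n₂ ^ 2 ≤ I * S := by
    rw [← hSq, show I = ∑ j ∈ Finset.Icc 1 p, A j from H.sum_coeff.symm]
    refine Finset.sum_sq_le_sum_mul_sum_of_sq_le_mul _ (fun j hj => (H.coeff_pos j hj).le)
      (fun j hj => mul_nonneg (H.coeff_pos j hj).le (sq_nonneg _)) fun j _ => ?_
    rw [mul_pow, sq_abs]
    exact le_of_eq (by ring)
  have h3 : S ≤ ρ * (n₁ + n₂) + |γ| * (ε * n₂) := by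
    have hq := H.abs_quad_le_of_integral_eq_zero (ρ := ρ) (T := (T - ψ) * χ)
      (F := fun t => (Φ t - ψ.eval t) * χ.eval t) (h := fun t => χ.eval t)
      ((H.continuousOn_sub_eval ψ).mul hχc) hχc
      (natDegree_mul_le.trans (by
        have := (natDegree_sub_le T ψ).trans (max_le hT (hψ.trans (Nat.sub_le _ _)))
        omega))
      (fun t ht => by
        have : (Φ t - ψ.eval t) * χ.eval t - ((T - ψ) * χ).eval t
            = (Φ t - T.eval t) * χ.eval t := by
          rw [eval_mul, eval_sub]
          ring
        rw [this, abs_mul]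
        exact mul_le_mul_of_nonneg_right (hΦT t ht) (abs_nonneg _))
      (H.orth χ hχ)
    have hqe := H.abs_quad_le (F := fun t => e t * χ.eval t) (h := fun t => χ.eval t) (ρ := ε)
      (fun t ht => by
        rw [abs_mul]
        exact mul_le_mul_of_nonneg_right (he t ht) (abs_nonneg _))
    have hsplit : S = ∑ j ∈ Finset.Icc 1 p, A j * ((Φ (g j) - ψ.eval (g j)) * χ.eval (g j))
        - γ * ∑ j ∈ Finset.Icc 1 p, A j * (e (g j) * χ.eval (g j)) := by
      rw [← hSq, Finset.mul_sum, ← Finset.sum_sub_distrib]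
      refine Finset.sum_congr rfl fun j hj => ?_
      rw [sq]
      nth_rewrite 1 [H.corr_eq j hj]
      ring
    rw [hsplit]
    refine (le_abs_self _).trans ((abs_sub _ _).trans ?_)
    rw [abs_mul]
    exact add_le_add hq (mul_le_mul_of_nonneg_left hqe (abs_nonneg _))
  have hm : max n₁ n₂ ≤ I * (2 * ρ + |γ| * ε) := by
    refine le_mul_of_sq_le_of_le_mul (S := S) hI.le (by positivity)
      (hn₁0.trans (le_max_left _ _)) ?_ ?_
    · rcases max_choice n₁ n₂ with h | h <;> rw [h] <;> assumption
    · have e1 := mul_le_mul_of_nonneg_left (le_max_left n₁ n₂) hρ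
      have e2 := mul_le_mul_of_nonneg_left (le_max_right n₁ n₂) hρ
      have e3 := mul_le_mul_of_nonneg_left (le_max_right n₁ n₂)
        (mul_nonneg (abs_nonneg γ) hε)
      linarith
  exact (le_max_left _ _).trans hm

theorem abs_integral_corr_le_of_mem (H : IsElementData p l r γ w Φ e g A ψ χ) {t : ℝ}
    (ht : t ∈ Icc l r) :
    |∫ s in l..t, χ.eval s * w s| ≤ ∫ s in l..r, |χ.eval s| * w s :=
  abs_integral_le_integral_abs_mul ht H.weight_int H.weight_pos χ.continuous.continuousOn

theorem integral_err_eq_zero (H : IsElementData p l r γ w Φ e g A ψ χ) (hp : 2 ≤ p) {c : ℝ}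
    (hc : ∀ t ∈ Icc l r, w t = c) (hr : e r = 0)
    (hd : ∀ t ∈ Ioo l r, HasDerivAt e ((Φ t - ψ.eval t) * w t) t) :
    ∫ t in l..r, e t * w t = 0 := by
  have hle := H.lt.le
  have hEc' : ContinuousOn (fun t => Φ t - ψ.eval t) (uIcc l r) := by
    rw [uIcc_of_le hle]
    exact H.continuousOn_sub_eval ψ
  have hec' : ContinuousOn e (uIcc l r) := by rw [uIcc_of_le hle]; exact H.err_cont
  have hlin : ContinuousOn (fun t : ℝ => t - l) (uIcc l r) := by fun_prop
  have i1 : IntervalIntegrable e volume l r := hec'.intervalIntegrable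
  have i2 : IntervalIntegrable (fun t => (Φ t - ψ.eval t) * (t - l) * w t) volume l r :=
    H.weight_int.continuousOn_mul (hEc'.mul hlin)
  have hparts := intervalIntegral.integral_eq_sub_of_hasDerivAt_of_le hle
    (f := fun t => e t * (t - l)) (f' := fun t => e t + (Φ t - ψ.eval t) * (t - l) * w t)
    (H.err_cont.mul (by fun_prop))
    (fun t ht => by
      exact ((hd t ht).mul ((hasDerivAt_id' t).sub_const l)).congr_deriv (by ring))
    (i1.add i2)
  have horth := H.orth (X - C l) (by rw [natDegree_X_sub_C]; omega)
  simp only [eval_sub, eval_X, eval_C] at horth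
  rw [intervalIntegral.integral_add i1 i2, horth] at hparts
  have : ∫ t in l..r, e t * w t = ∫ t in l..r, e t * c :=
    intervalIntegral.integral_congr fun t ht => by
      rw [uIcc_of_le hle] at ht
      simp only [hc t ht]
  rw [this, intervalIntegral.integral_mul_const]
  have h0 : ∫ t in l..r, e t = 0 := by
    rw [hr] at hparts
    simpa using hparts
  rw [h0, zero_mul]

/-- On an element where the weight is constant, the increment of the corrector is governed by the
quadrature errors for the flux error and for the projection error. -/
theorem abs_integral_corr_le (H : IsElementData p l r γ w Φ e g A ψ χ) {ρ ρ' : ℝ} {T T' : ℝ[X]}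
    (hT : T.natDegree ≤ 2 * p - 1) (hΦT : ∀ t ∈ Icc l r, |Φ t - T.eval t| ≤ ρ)
    (hT' : T'.natDegree ≤ 2 * p - 1) (heT' : ∀ t ∈ Icc l r, |e t - T'.eval t| ≤ ρ')
    (hez : ∫ t in l..r, e t * w t = 0) :
    |∫ s in l..r, χ.eval s * w s| ≤ 2 * (ρ + |γ| * ρ') * ∫ t in l..r, w t := by
  have hp := H.one_le
  have hψ := H.proj_deg
  have hχ := H.corr_deg
  have h1 := H.abs_quad_le_const_of_integral_eq_zero (ρ := ρ) (T := T - ψ)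
    (H.continuousOn_sub_eval ψ)
    ((natDegree_sub_le _ _).trans (max_le hT (by omega)))
    (fun t ht => by
      rw [eval_sub, sub_sub_sub_cancel_right]
      exact hΦT t ht)
    (by simpa using H.orth 1 (by simp))
  have h2 := H.abs_quad_le_const_of_integral_eq_zero H.err_cont hT' heT' hez
  rw [← H.quad χ (by omega)]
  have hsplit : ∑ j ∈ Finset.Icc 1 p, A j * χ.eval (g j)
      = ∑ j ∈ Finset.Icc 1 p, A j * (Φ (g j) - ψ.eval (g j))
        - γ * ∑ j ∈ Finset.Icc 1 p, A j * e (g j) := by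
    rw [Finset.mul_sum, ← Finset.sum_sub_distrib]
    refine Finset.sum_congr rfl fun j hj => ?_
    rw [H.corr_eq j hj]
    ring
  rw [hsplit]
  refine (abs_sub _ _).trans ?_
  rw [abs_mul]
  have := mul_le_mul_of_nonneg_left h2 (abs_nonneg γ)
  linarith

end IsElementData

theorem betaPW_of_lt {βm βp α t : ℝ} (h : t < α) : betaPW βm βp α t = βm := if_pos h

theorem betaPW_of_le {βm βp α t : ℝ} (h : α ≤ t) : betaPW βm βp α t = βp :=
  if_neg (not_lt.2 h)

theorem betaPW_pos {βm βp : ℝ} (hβm : 0 < βm) (hβp : 0 < βp) (α t : ℝ) :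
    0 < betaPW βm βp α t := by
  unfold betaPW
  split_ifs <;> assumption

theorem measurable_betaPW (βm βp α : ℝ) : Measurable (betaPW βm βp α) :=
  Measurable.ite measurableSet_Iio measurable_const measurable_const

theorem inv_betaPW_le {βm βp : ℝ} (hβm : 0 < βm) (hβp : 0 < βp) (α t : ℝ) :
    (betaPW βm βp α t)⁻¹ ≤ βm⁻¹ + βp⁻¹ := by
  have := inv_pos.2 hβm
  have := inv_pos.2 hβp
  unfold betaPW
  split_ifs <;> linarith

theorem intervalIntegrable_inv_betaPW {βm βp : ℝ} (hβm : 0 < βm) (hβp : 0 < βp) (α l r : ℝ) :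
    IntervalIntegrable (fun t => (betaPW βm βp α t)⁻¹) volume l r := by
  rw [intervalIntegrable_iff]
  refine Measure.integrableOn_of_bounded (M := βm⁻¹ + βp⁻¹) (by simp)
    (measurable_betaPW βm βp α).inv.aestronglyMeasurable (ae_of_all _ fun t => ?_)
  rw [Real.norm_eq_abs, abs_of_pos (inv_pos.2 (betaPW_pos hβm hβp α t))]
  exact inv_betaPW_le hβm hβp α t

theorem integral_inv_betaPW_le {βm βp : ℝ} (hβm : 0 < βm) (hβp : 0 < βp) (α : ℝ) {l r : ℝ}
    (hlr : l ≤ r) :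
    ∫ t in l..r, (betaPW βm βp α t)⁻¹ ≤ (βm⁻¹ + βp⁻¹) * (r - l) := by
  have := intervalIntegral.integral_mono_on hlr (intervalIntegrable_inv_betaPW hβm hβp α l r)
    (intervalIntegrable_const (c := βm⁻¹ + βp⁻¹)) fun t _ => inv_betaPW_le hβm hβp α t
  rw [intervalIntegral.integral_const, smul_eq_mul] at this
  linarith

/-- `f` is continuous on `[l, r]` and `Φ` is its flux `β f'` there, away from `α`. -/
def HasFluxOn (βm βp α : ℝ) (f Φ : ℝ → ℝ) (l r : ℝ) : Prop :=
  ContinuousOn f (Icc l r) ∧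
    ∀ t ∈ Ioo l r, t ≠ α → HasDerivAt f (Φ t * (betaPW βm βp α t)⁻¹) t

namespace HasFluxOn

variable {βm βp α l r : ℝ} {f f' Φ Φ' : ℝ → ℝ}

theorem sub (h : HasFluxOn βm βp α f Φ l r) (h' : HasFluxOn βm βp α f' Φ' l r) :
    HasFluxOn βm βp α (fun t => f t - f' t) (fun t => Φ t - Φ' t) l r :=
  ⟨h.1.sub h'.1, fun t ht hα =>
    ((h.2 t ht hα).sub (h'.2 t ht hα)).congr_deriv (by ring)⟩

theorem integral_eq (h : HasFluxOn βm βp α f Φ l r) (hβm : 0 < βm) (hβp : 0 < βp)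
    (hΦ : ContinuousOn Φ (Icc l r)) {t : ℝ} (ht : t ∈ Icc l r) :
    ∫ s in l..t, Φ s * (betaPW βm βp α s)⁻¹ = f t - f l := by
  refine integral_eq_of_hasDerivAt_off_countable_of_le f _ ht.1
    (countable_singleton α) (h.1.mono (Icc_subset_Icc_right ht.2))
    (fun s hs => h.2 s ⟨hs.1.1, hs.1.2.trans_le ht.2⟩ hs.2) ?_
  refine (intervalIntegrable_inv_betaPW hβm hβp α l t).continuousOn_mul ?_
  rw [uIcc_of_le ht.1]
  exact hΦ.mono (Icc_subset_Icc_right ht.2)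

theorem betaPW_mul_deriv (h : HasFluxOn βm βp α f Φ l r) (hβm : 0 < βm) (hβp : 0 < βp) {t : ℝ}
    (ht : t ∈ Ioo l r) (hα : t ≠ α) : betaPW βm βp α t * deriv f t = Φ t := by
  rw [(h.2 t ht hα).deriv]
  field_simp [(betaPW_pos hβm hβp α t).ne']

end HasFluxOn

theorem eval_iterate_derivative_of_derivative_eq {q χ : ℝ[X]} {β : ℝ} (hβ : 0 < β)
    (h : derivative q = C β⁻¹ * χ) (α : ℝ) {j : ℕ} (hj : 1 ≤ j) :
    β * (derivative^[j] q).eval α = (derivative^[j - 1] χ).eval α := by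
  obtain ⟨j, rfl⟩ := Nat.exists_eq_add_of_le' hj
  rw [Function.iterate_succ_apply, h, iterate_derivative_C_mul, eval_mul, eval_C,
    Nat.add_sub_cancel, ← mul_assoc, mul_inv_cancel₀ hβ.ne', one_mul]

theorem eq_of_eval_iterate_derivative_eq {P Q : ℝ[X]} {α : ℝ} {n : ℕ} (hP : P.natDegree ≤ n)
    (hQ : Q.natDegree ≤ n)
    (h : ∀ j ≤ n, (derivative^[j] P).eval α = (derivative^[j] Q).eval α) : P = Q := by
  rw [← sub_eq_zero]
  refine eq_zero_of_hasseDeriv_eq_zero _ α fun k => ?_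
  have hk : (derivative^[k] (P - Q)).eval α = 0 := by
    by_cases hkn : k ≤ n
    · rw [iterate_derivative_sub, eval_sub, h k hkn, sub_self]
    · rw [iterate_derivative_eq_zero, eval_zero]
      exact ((natDegree_sub_le _ _).trans (max_le hP hQ)).trans_lt (not_le.1 hkn)
  rw [← factorial_smul_hasseDeriv, LinearMap.smul_apply, eval_smul, nsmul_eq_mul] at hk
  exact (mul_eq_zero.1 hk).resolve_left (by positivity)

section Flux

variable {p : ℕ} {βm βp α l r c : ℝ} {f : ℝ → ℝ}

theorem exists_flux_of_const (hc : 0 < c) (hβ : ∀ t ∈ Icc l r, betaPW βm βp α t = c)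
    (h : ∃ q : ℝ[X], q.natDegree ≤ p ∧ ∀ y ∈ Icc l r, f y = q.eval y) :
    ∃ ψ : ℝ[X], ψ.natDegree ≤ p - 1 ∧ HasFluxOn βm βp α f (fun t => ψ.eval t) l r := by
  obtain ⟨q, hq, hfq⟩ := h
  refine ⟨C c * derivative q, (natDegree_C_mul_le _ _).trans
    ((natDegree_derivative_le q).trans (by omega)),
    q.continuous.continuousOn.congr hfq, fun t ht _ => ?_⟩
  have : f =ᶠ[nhds t] fun y => q.eval y := by
    filter_upwards [Icc_mem_nhds ht.1 ht.2] with y hy using hfq y hy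
  refine ((q.hasDerivAt t).congr_of_eventuallyEq this).congr_deriv ?_
  simp only [hβ t (Ioo_subset_Icc_self ht), eval_mul, eval_C]
  field_simp

theorem exists_flux_of_interface (hp : 1 ≤ p) (hβm : 0 < βm) (hβp : 0 < βp) (hl : l < α)
    (hr : α < r)
    (h : ∃ qm qp : ℝ[X], qm.natDegree ≤ p ∧ qp.natDegree ≤ p ∧
      (∀ y ∈ Icc l α, f y = qm.eval y) ∧ (∀ y ∈ Icc α r, f y = qp.eval y) ∧
      ∀ j, 1 ≤ j → j ≤ p →
        βm * (derivative^[j] qm).eval α = βp * (derivative^[j] qp).eval α) :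
    ∃ ψ : ℝ[X], ψ.natDegree ≤ p - 1 ∧ HasFluxOn βm βp α f (fun t => ψ.eval t) l r := by
  obtain ⟨qm, qp, hqm, hqp, hfm, hfp, hj⟩ := h
  have hdm : (C βm * derivative qm).natDegree ≤ p - 1 :=
    (natDegree_C_mul_le _ _).trans ((natDegree_derivative_le qm).trans (by omega))
  have hdp : (C βp * derivative qp).natDegree ≤ p - 1 :=
    (natDegree_C_mul_le _ _).trans ((natDegree_derivative_le qp).trans (by omega))
  have heq : C βm * derivative qm = C βp * derivative qp :=
    eq_of_eval_iterate_derivative_eq hdm hdp (α := α) fun j hjp => by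
      have := hj (j + 1) (by omega) (by omega)
      rw [Function.iterate_succ_apply, Function.iterate_succ_apply] at this
      rwa [iterate_derivative_C_mul, iterate_derivative_C_mul, eval_mul, eval_mul, eval_C, eval_C]
  refine ⟨C βm * derivative qm, hdm, ?_, fun t ht hα => ?_⟩
  · rw [← Icc_union_Icc_eq_Icc hl.le hr.le]
    exact (qm.continuous.continuousOn.congr hfm).union_of_isClosed
      (qp.continuous.continuousOn.congr hfp) isClosed_Icc isClosed_Icc
  · rcases lt_or_gt_of_ne hα with hα | hα
    · have : f =ᶠ[nhds t] fun y => qm.eval y := by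
        filter_upwards [Icc_mem_nhds ht.1 hα] with y hy using hfm y hy
      refine ((qm.hasDerivAt t).congr_of_eventuallyEq this).congr_deriv ?_
      simp only [betaPW_of_lt hα, eval_mul, eval_C]
      field_simp
    · have : f =ᶠ[nhds t] fun y => qp.eval y := by
        filter_upwards [Icc_mem_nhds hα ht.2] with y hy using hfp y hy
      refine ((qp.hasDerivAt t).congr_of_eventuallyEq this).congr_deriv ?_
      simp only [heq, betaPW_of_le hα.le, eval_mul, eval_C]
      field_simp

theorem integral_eval_mul_inv_betaPW {χ P : ℝ[X]} (hP : derivative P = χ)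
    {s t : ℝ} (hβ : ∀ y ∈ Ioo (min s t) (max s t), betaPW βm βp α y = c) :
    ∫ y in s..t, χ.eval y * (betaPW βm βp α y)⁻¹ = c⁻¹ * (P.eval t - P.eval s) := by
  have h1 : ∫ y in s..t, χ.eval y * (betaPW βm βp α y)⁻¹ = ∫ y in s..t, χ.eval y * c⁻¹ :=
    intervalIntegral.integral_congr_uIoo fun y hy => by simp only [hβ y hy]
  have h2 : ∫ y in s..t, χ.eval y = P.eval t - P.eval s :=
    intervalIntegral.integral_eq_sub_of_hasDerivAt
      (fun y _ => hP ▸ P.hasDerivAt y) (χ.continuous.intervalIntegrable _ _)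
  rw [h1, intervalIntegral.integral_mul_const, h2, mul_comm]

theorem exists_polynomial_eq_integral_of_const
    (hβ : ∀ t ∈ Icc l r, betaPW βm βp α t = c) (hp : 1 ≤ p) {χ : ℝ[X]}
    (hχ : χ.natDegree ≤ p - 1) (K : ℝ)
    (hf : ∀ t ∈ Icc l r, f t = K + ∫ s in l..t, χ.eval s * (betaPW βm βp α s)⁻¹) :
    ∃ q : ℝ[X], q.natDegree ≤ p ∧ ∀ y ∈ Icc l r, f y = q.eval y := by
  obtain ⟨P, hP, hPd⟩ := exists_derivative_eq χ hχ
  rw [Nat.sub_add_cancel hp] at hPd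
  refine ⟨C K + C c⁻¹ * (P - C (P.eval l)), ?_, fun y hy => ?_⟩
  · refine (natDegree_add_le _ _).trans (max_le (by simp) ?_)
    refine (natDegree_C_mul_le _ _).trans ?_
    rwa [natDegree_sub_C]
  · rw [hf y hy, integral_eval_mul_inv_betaPW (c := c) hP]
    · simp
    · intro z hz
      rw [min_eq_left hy.1, max_eq_right hy.1] at hz
      exact hβ z ⟨hz.1.le, hz.2.le.trans hy.2⟩

theorem exists_polynomial_eq_integral_of_interface (hβm : 0 < βm) (hβp : 0 < βp) (hl : l < α)
    (hp : 1 ≤ p) {χ : ℝ[X]} (hχ : χ.natDegree ≤ p - 1) (K : ℝ)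
    (hf : ∀ t ∈ Icc l r, f t = K + ∫ s in l..t, χ.eval s * (betaPW βm βp α s)⁻¹)
    (hr : α < r) :
    ∃ qm qp : ℝ[X], qm.natDegree ≤ p ∧ qp.natDegree ≤ p ∧
      (∀ y ∈ Icc l α, f y = qm.eval y) ∧ (∀ y ∈ Icc α r, f y = qp.eval y) ∧
      ∀ j, 1 ≤ j → j ≤ p →
        βm * (derivative^[j] qm).eval α = βp * (derivative^[j] qp).eval α := by
  obtain ⟨P, hP, hPd⟩ := exists_derivative_eq χ hχ
  rw [Nat.sub_add_cancel hp] at hPd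
  have hdeg : ∀ a b c : ℝ, (C a + C b * (P - C c)).natDegree ≤ p := fun a b c => by
    refine (natDegree_add_le _ _).trans (max_le (by simp) ?_)
    refine (natDegree_C_mul_le _ _).trans ?_
    rwa [natDegree_sub_C]
  have hleft : ∀ y ∈ Icc l α,
      ∫ s in l..y, χ.eval s * (betaPW βm βp α s)⁻¹ = βm⁻¹ * (P.eval y - P.eval l) :=
    fun y hy => integral_eval_mul_inv_betaPW hP fun z hz => by
      rw [min_eq_left hy.1, max_eq_right hy.1] at hz
      exact betaPW_of_lt (hz.2.trans_le hy.2)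
  have hright : ∀ y ∈ Icc α r,
      ∫ s in α..y, χ.eval s * (betaPW βm βp α s)⁻¹ = βp⁻¹ * (P.eval y - P.eval α) :=
    fun y hy => integral_eval_mul_inv_betaPW hP fun z hz => by
      rw [min_eq_left hy.1] at hz
      exact betaPW_of_le hz.1.le
  refine ⟨C K + C βm⁻¹ * (P - C (P.eval l)),
    C (K + βm⁻¹ * (P.eval α - P.eval l)) + C βp⁻¹ * (P - C (P.eval α)),
    hdeg _ _ _, hdeg _ _ _, fun y hy => ?_, fun y hy => ?_, fun j hj _ => ?_⟩
  · rw [hf y ⟨hy.1, hy.2.trans hr.le⟩, hleft y hy]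
    simp
  · have hinteg : ∀ s t, IntervalIntegrable (fun s => χ.eval s * (betaPW βm βp α s)⁻¹) volume s t :=
      fun s t => (intervalIntegrable_inv_betaPW hβm hβp α s t).continuousOn_mul
        χ.continuous.continuousOn
    rw [hf y ⟨hl.le.trans hy.1, hy.2⟩,
      ← intervalIntegral.integral_add_adjacent_intervals (hinteg l α) (hinteg α y),
      hleft α ⟨hl.le, le_rfl⟩, hright y hy]
    simp
    ring
  · rw [eval_iterate_derivative_of_derivative_eq (χ := χ) hβm (by simp [hP]) α hj,
      eval_iterate_derivative_of_derivative_eq (χ := χ) hβp (by simp [hP]) α hj]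

end Flux

section Orthogonality

variable {p : ℕ} {βm βp α l r c : ℝ} {u v Φ : ℝ → ℝ} {ψ : ℝ[X]}

theorem HasFluxOn.betaPW_mul_deriv_sub_deriv (hβm : 0 < βm) (hβp : 0 < βp)
    (hu : HasFluxOn βm βp α u Φ l r)
    (hv : HasFluxOn βm βp α v (fun t => ψ.eval t) l r) {t : ℝ} (ht : t ∈ Ioo l r) (hα : t ≠ α) :
    betaPW βm βp α t * (deriv u t - deriv v t) = Φ t - ψ.eval t := by
  rw [mul_sub, hu.betaPW_mul_deriv hβm hβp ht hα, hv.betaPW_mul_deriv hβm hβp ht hα]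

theorem orthogonal_of_const (hβm : 0 < βm) (hβp : 0 < βp) (hlr : l ≤ r) (hp : 1 ≤ p)
    (hβ : ∀ t ∈ Icc l r, betaPW βm βp α t = c) (hα : α ∉ Ioo l r)
    (hu : HasFluxOn βm βp α u Φ l r)
    (hv : HasFluxOn βm βp α v (fun t => ψ.eval t) l r)
    (h : ∀ q : ℝ[X], q.natDegree ≤ p →
      ∫ t in l..r, betaPW βm βp α t * (deriv u t - deriv v t) * (derivative q).eval t = 0)
    (q : ℝ[X]) (hq : q.natDegree ≤ p - 1) :
    ∫ t in l..r, (Φ t - ψ.eval t) * q.eval t * (betaPW βm βp α t)⁻¹ = 0 := by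
  obtain ⟨P, hP, hPd⟩ := exists_derivative_eq q hq
  rw [Nat.sub_add_cancel hp] at hPd
  rw [← h (C c⁻¹ * P) ((natDegree_C_mul_le _ _).trans hPd)]
  refine intervalIntegral.integral_congr_Ioo_of_le hlr fun t ht => ?_
  rw [hu.betaPW_mul_deriv_sub_deriv hβm hβp hv ht fun h => hα (h ▸ ht), derivative_C_mul,
    hP, eval_mul, eval_C, hβ t (Ioo_subset_Icc_self ht)]
  ring

theorem orthogonal_of_interface (hβm : 0 < βm) (hβp : 0 < βp) (hl : l < α) (hr : α < r)
    (hp : 1 ≤ p) (hΦ : ContinuousOn Φ (Icc l r))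
    (hu : HasFluxOn βm βp α u Φ l r)
    (hv : HasFluxOn βm βp α v (fun t => ψ.eval t) l r)
    (h : ∀ qm qp : ℝ[X], qm.natDegree ≤ p → qp.natDegree ≤ p → qm.eval α = qp.eval α →
      (∀ j, 1 ≤ j → j ≤ p →
        βm * (derivative^[j] qm).eval α = βp * (derivative^[j] qp).eval α) →
      (∫ t in l..α,
          betaPW βm βp α t * (deriv u t - deriv v t) * (derivative qm).eval t)
        + (∫ t in α..r,
            betaPW βm βp α t * (deriv u t - deriv v t) * (derivative qp).eval t) = 0)
    (q : ℝ[X]) (hq : q.natDegree ≤ p - 1) :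
    ∫ t in l..r, (Φ t - ψ.eval t) * q.eval t * (betaPW βm βp α t)⁻¹ = 0 := by
  obtain ⟨P, hP, hPd⟩ := exists_derivative_eq q hq
  rw [Nat.sub_add_cancel hp] at hPd
  have hdeg : ∀ b c : ℝ, (C b * (P - C c)).natDegree ≤ p := fun b c => by
    refine (natDegree_C_mul_le _ _).trans ?_
    rwa [natDegree_sub_C]
  have hinteg : ∀ s t, l ≤ s → s ≤ t → t ≤ r →
      IntervalIntegrable (fun t => (Φ t - ψ.eval t) * q.eval t * (betaPW βm βp α t)⁻¹)
        volume s t := fun s t hs hst ht => by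
    refine (intervalIntegrable_inv_betaPW hβm hβp α s t).continuousOn_mul ?_
    rw [uIcc_of_le hst]
    exact ((hΦ.mono (Icc_subset_Icc hs ht)).sub ψ.continuous.continuousOn).mul
      q.continuous.continuousOn
  rw [← intervalIntegral.integral_add_adjacent_intervals (hinteg l α le_rfl hl.le hr.le)
    (hinteg α r hl.le hr.le le_rfl),
    ← h (C βm⁻¹ * (P - C (P.eval α))) (C βp⁻¹ * (P - C (P.eval α))) (hdeg _ _) (hdeg _ _)
      (by simp) fun j hj _ => by
        rw [eval_iterate_derivative_of_derivative_eq (χ := q) hβm (by simp [hP]) α hj,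
          eval_iterate_derivative_of_derivative_eq (χ := q) hβp (by simp [hP]) α hj]]
  congr 1
  · refine intervalIntegral.integral_congr_Ioo_of_le hl.le fun t ht => ?_
    rw [hu.betaPW_mul_deriv_sub_deriv hβm hβp hv ⟨ht.1, ht.2.trans hr⟩ ht.2.ne,
      derivative_C_mul, derivative_sub, derivative_C, sub_zero,
      hP, eval_mul, eval_C, betaPW_of_lt ht.2]
    ring
  · refine intervalIntegral.integral_congr_Ioo_of_le hr.le fun t ht => ?_
    rw [hu.betaPW_mul_deriv_sub_deriv hβm hβp hv ⟨hl.trans ht.1, ht.2⟩ ht.1.ne',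
      derivative_C_mul, derivative_sub, derivative_C, sub_zero,
      hP, eval_mul, eval_C, betaPW_of_le ht.1.le]
    ring

end Orthogonality

theorem abs_iteratedDerivWithin_le_sSup {f : ℝ → ℝ} {a b : ℝ} (hab : a < b) {m : ℕ}
    (hf : ContDiffOn ℝ (m : ℕ∞) f (Icc a b)) {j : ℕ} (hj : j ≤ m) {t : ℝ} (ht : t ∈ Icc a b) :
    |iteratedDerivWithin j f (Icc a b) t|
      ≤ sSup {y : ℝ | ∃ j ≤ m, ∃ t ∈ Icc a b, y = |iteratedDerivWithin j f (Icc a b) t|} := by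
  refine le_csSup ?_ ⟨j, hj, t, ht, rfl⟩
  have hbdd : BddAbove (⋃ j ∈ Set.Iic m,
      (fun t => |iteratedDerivWithin j f (Icc a b) t|) '' Icc a b) := by
    refine (Set.finite_Iic m).bddAbove_biUnion.2 fun j hj => ?_
    refine (isCompact_Icc.image_of_continuousOn ?_).bddAbove
    exact (hf.continuousOn_iteratedDerivWithin (by exact_mod_cast hj) (uniqueDiffOn_Icc hab)).abs
  refine hbdd.mono ?_
  rintro y ⟨j, hj, t, ht, rfl⟩
  exact mem_biUnion (Set.mem_Iic.2 hj) (mem_image_of_mem _ ht)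

theorem hasDerivWithinAt_iteratedDerivWithin {f : ℝ → ℝ} {a b : ℝ} (hab : a < b) {m : ℕ}
    (hf : ContDiffOn ℝ (m : ℕ∞) f (Icc a b)) {j : ℕ} (hj : j < m) {t : ℝ} (ht : t ∈ Icc a b) :
    HasDerivWithinAt (iteratedDerivWithin j f (Icc a b))
      (iteratedDerivWithin (j + 1) f (Icc a b) t) (Icc a b) t := by
  rw [iteratedDerivWithin_succ]
  exact (hf.differentiableOn_iteratedDerivWithin (by exact_mod_cast hj) (uniqueDiffOn_Icc hab)
    t ht).hasDerivWithinAt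

/-- The flux `β u'` of a function that is differentiable on `[a, α]` and on `[α, b]`. -/
noncomputable def fluxPW (a b α βm βp : ℝ) (u : ℝ → ℝ) (t : ℝ) : ℝ :=
  if t < α then βm * iteratedDerivWithin 1 u (Icc a α) t
  else βp * iteratedDerivWithin 1 u (Icc α b) t

namespace MemW

variable {m : ℕ} {a b α βm βp : ℝ} {u : ℝ → ℝ}

theorem abs_left_le (h : MemW m a b α βm βp u) (ha : a < α) {j : ℕ} (hj : j ≤ m) {t : ℝ}
    (ht : t ∈ Icc a α) : |iteratedDerivWithin j u (Icc a α) t| ≤ wnorm m a b α u :=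
  (abs_iteratedDerivWithin_le_sSup ha h.2.2.2.1 hj ht).trans (le_max_left _ _)

theorem abs_right_le (h : MemW m a b α βm βp u) (hb : α < b) {j : ℕ} (hj : j ≤ m) {t : ℝ}
    (ht : t ∈ Icc α b) : |iteratedDerivWithin j u (Icc α b) t| ≤ wnorm m a b α u :=
  (abs_iteratedDerivWithin_le_sSup hb h.2.2.2.2.1 hj ht).trans (le_max_right _ _)

theorem wnorm_nonneg (h : MemW m a b α βm βp u) (ha : a < α) : 0 ≤ wnorm m a b α u :=
  (abs_nonneg _).trans (h.abs_left_le ha (Nat.zero_le m) (left_mem_Icc.2 ha.le))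

theorem fluxPW_left (h : MemW m a b α βm βp u) (hm : 1 ≤ m) {t : ℝ} (ht : t ≤ α) :
    fluxPW a b α βm βp u t = βm * iteratedDerivWithin 1 u (Icc a α) t := by
  rcases ht.eq_or_lt with rfl | ht
  · rw [fluxPW, if_neg (lt_irrefl _), h.2.2.2.2.2 1 le_rfl hm]
  · rw [fluxPW, if_pos ht]

theorem fluxPW_right {t : ℝ} (ht : α ≤ t) :
    fluxPW a b α βm βp u t = βp * iteratedDerivWithin 1 u (Icc α b) t := by
  rw [fluxPW, if_neg (not_lt.2 ht)]

theorem continuousOn_fluxPW (h : MemW m a b α βm βp u) (hm : 1 ≤ m) (ha : a < α) (hb : α < b) :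
    ContinuousOn (fluxPW a b α βm βp u) (Icc a b) := by
  rw [← Icc_union_Icc_eq_Icc ha.le hb.le]
  refine ContinuousOn.union_of_isClosed ?_ ?_ isClosed_Icc isClosed_Icc
  · exact (continuousOn_const.mul (h.2.2.2.1.continuousOn_iteratedDerivWithin
      (by exact_mod_cast hm) (uniqueDiffOn_Icc ha))).congr fun t ht => h.fluxPW_left hm ht.2
  · exact (continuousOn_const.mul (h.2.2.2.2.1.continuousOn_iteratedDerivWithin
      (by exact_mod_cast hm) (uniqueDiffOn_Icc hb))).congr fun t ht => fluxPW_right ht.1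

theorem hasFluxOn (h : MemW m a b α βm βp u) (hm : 1 ≤ m) (ha : a < α) (hb : α < b)
    (hβm : 0 < βm) (hβp : 0 < βp) {l r : ℝ} (hl : a ≤ l) (hr : r ≤ b) :
    HasFluxOn βm βp α u (fluxPW a b α βm βp u) l r := by
  refine ⟨h.1.mono (Icc_subset_Icc hl hr), fun t ht hα => ?_⟩
  have ht' : t ∈ Ioo a b := ⟨hl.trans_lt ht.1, ht.2.trans_le hr⟩
  rcases lt_or_gt_of_ne hα with hα | hα
  · have := hasDerivWithinAt_iteratedDerivWithin ha h.2.2.2.1 (j := 0) (by omega)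
      ⟨ht'.1.le, hα.le⟩
    rw [iteratedDerivWithin_zero] at this
    refine (this.hasDerivAt (Icc_mem_nhds ht'.1 hα)).congr_deriv ?_
    rw [h.fluxPW_left hm hα.le, betaPW_of_lt hα]
    field_simp
  · have := hasDerivWithinAt_iteratedDerivWithin hb h.2.2.2.2.1 (j := 0) (by omega)
      ⟨hα.le, ht'.2.le⟩
    rw [iteratedDerivWithin_zero] at this
    refine (this.hasDerivAt (Icc_mem_nhds hα ht'.2)).congr_deriv ?_
    rw [fluxPW_right hα.le, betaPW_of_le hα.le]
    field_simp

theorem abs_fluxPW_sub_left_le (h : MemW m a b α βm βp u) (ha : a < α) (hβm : 0 < βm) {n : ℕ}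
    (hn : n + 1 ≤ m) {c : ℝ} (hc : c ∈ Icc a α) {t : ℝ} (ht : t ∈ Icc a α) :
    |fluxPW a b α βm βp u t - (taylorSeqPoly
      (fun j t => βm * iteratedDerivWithin (j + 1) u (Icc a α) t) c n).eval t|
      ≤ βm * wnorm m a b α u * |t - c| ^ n := by
  rw [h.fluxPW_left (by omega) ht.2]
  refine abs_sub_eval_taylorSeqPoly_le (convex_Icc a α) hc n
    (fun j t => βm * iteratedDerivWithin (j + 1) u (Icc a α) t)
    (fun j hj t ht => (hasDerivWithinAt_iteratedDerivWithin ha h.2.2.2.1 (by omega) ht).const_mul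
      βm) (fun t ht => ?_) t ht
  rw [abs_mul, abs_of_pos hβm]
  exact mul_le_mul_of_nonneg_left (h.abs_left_le ha hn ht) hβm.le

theorem abs_fluxPW_sub_right_le (h : MemW m a b α βm βp u) (hb : α < b) (hβp : 0 < βp) {n : ℕ}
    (hn : n + 1 ≤ m) {c : ℝ} (hc : c ∈ Icc α b) {t : ℝ} (ht : t ∈ Icc α b) :
    |fluxPW a b α βm βp u t - (taylorSeqPoly
      (fun j t => βp * iteratedDerivWithin (j + 1) u (Icc α b) t) c n).eval t|
      ≤ βp * wnorm m a b α u * |t - c| ^ n := by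
  rw [fluxPW_right ht.1]
  refine abs_sub_eval_taylorSeqPoly_le (convex_Icc α b) hc n
    (fun j t => βp * iteratedDerivWithin (j + 1) u (Icc α b) t)
    (fun j hj t ht => (hasDerivWithinAt_iteratedDerivWithin hb h.2.2.2.2.1 (by omega)
      ht).const_mul βp) (fun t ht => ?_) t ht
  rw [abs_mul, abs_of_pos hβp]
  exact mul_le_mul_of_nonneg_left (h.abs_right_le hb hn ht) hβp.le

/-- Polynomial approximation of the flux on an interval, with the interface allowed in it. -/
theorem exists_polynomial_fluxPW_approx (h : MemW m a b α βm βp u) (ha : a < α) (hb : α < b)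
    (hβm : 0 < βm) (hβp : 0 < βp) {l r : ℝ} (hl : a ≤ l) (hlr : l ≤ r) (hr : r ≤ b) {n : ℕ}
    (hn : n + 1 ≤ m) :
    ∃ T : ℝ[X], T.natDegree ≤ n - 1 ∧ ∀ t ∈ Icc l r, |fluxPW a b α βm βp u t - T.eval t|
      ≤ (βm + βp) * wnorm m a b α u * (r - l) ^ n := by
  have hM := h.wnorm_nonneg ha
  have hpow : ∀ c ∈ Icc l r, ∀ t ∈ Icc l r, |t - c| ^ n ≤ (r - l) ^ n := fun c hc t ht =>
    pow_le_pow_left₀ (abs_nonneg _) (abs_sub_le_iff.2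
      ⟨by linarith [ht.2, hc.1], by linarith [ht.1, hc.2]⟩) n
  have hwm : βm * wnorm m a b α u ≤ (βm + βp) * wnorm m a b α u := by gcongr; linarith
  have hwp : βp * wnorm m a b α u ≤ (βm + βp) * wnorm m a b α u := by gcongr; linarith
  have hl0 : 0 ≤ βm * wnorm m a b α u := by positivity
  have hp0 : 0 ≤ βp * wnorm m a b α u := by positivity
  have hw0 := hl0.trans hwm
  have hL : ∀ c ∈ Icc l r, c ∈ Icc a α → ∀ t ∈ Icc l r, t ≤ α →
      |fluxPW a b α βm βp u t - (taylorSeqPoly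
        (fun j t => βm * iteratedDerivWithin (j + 1) u (Icc a α) t) c n).eval t|
        ≤ (βm + βp) * wnorm m a b α u * (r - l) ^ n := fun c hc hc' t ht ht' =>
    (h.abs_fluxPW_sub_left_le ha hβm hn hc' ⟨hl.trans ht.1, ht'⟩).trans
      (mul_le_mul hwm (hpow c hc t ht) (by positivity) hw0)
  have hR : ∀ c ∈ Icc l r, c ∈ Icc α b → ∀ t ∈ Icc l r, α ≤ t →
      |fluxPW a b α βm βp u t - (taylorSeqPoly
        (fun j t => βp * iteratedDerivWithin (j + 1) u (Icc α b) t) c n).eval t|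
        ≤ (βm + βp) * wnorm m a b α u * (r - l) ^ n := fun c hc hc' t ht ht' =>
    (h.abs_fluxPW_sub_right_le hb hβp hn hc' ⟨ht', ht.2.trans hr⟩).trans
      (mul_le_mul hwp (hpow c hc t ht) (by positivity) hw0)
  by_cases h1 : r ≤ α
  · exact ⟨_, natDegree_taylorSeqPoly_le _ l n, fun t ht =>
      hL l ⟨le_rfl, hlr⟩ ⟨hl, hlr.trans h1⟩ t ht (ht.2.trans h1)⟩
  by_cases h2 : α ≤ l
  · exact ⟨_, natDegree_taylorSeqPoly_le _ l n, fun t ht =>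
      hR l ⟨le_rfl, hlr⟩ ⟨h2, hlr.trans hr⟩ t ht (h2.trans ht.1)⟩
  have hα : α ∈ Icc l r := ⟨(not_le.1 h2).le, (not_le.1 h1).le⟩
  refine ⟨_, natDegree_taylorSeqPoly_le
    (fun j t => βm * iteratedDerivWithin (j + 1) u (Icc a α) t) α n, fun t ht => ?_⟩
  rcases le_total t α with htα | htα
  · exact hL α hα ⟨ha.le, le_rfl⟩ t ht htα
  · have heq : taylorSeqPoly (fun j t => βm * iteratedDerivWithin (j + 1) u (Icc a α) t) α n
        = taylorSeqPoly (fun j t => βp * iteratedDerivWithin (j + 1) u (Icc α b) t) α n := by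
      refine Finset.sum_congr rfl fun j hj => ?_
      have := Finset.mem_range.1 hj
      simp only [h.2.2.2.2.2 (j + 1) (by omega) (by omega)]
    rw [heq]
    exact hR α hα ⟨le_rfl, hb.le⟩ t ht htα

theorem exists_polynomial_approx (h : MemW m a b α βm βp u) (ha : a < α) (hb : α < b)
    {l r : ℝ} (hl : a ≤ l) (hlr : l ≤ r) (hr : r ≤ b) (hα : r ≤ α ∨ α ≤ l) {n : ℕ}
    (hn : n ≤ m) :
    ∃ T : ℝ[X], T.natDegree ≤ n - 1 ∧ ∀ t ∈ Icc l r, |u t - T.eval t|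
      ≤ wnorm m a b α u * (r - l) ^ n := by
  have hM := h.wnorm_nonneg ha
  have hpow : ∀ t ∈ Icc l r, wnorm m a b α u * |t - l| ^ n ≤ wnorm m a b α u * (r - l) ^ n :=
    fun t ht => by
      rw [abs_of_nonneg (sub_nonneg.2 ht.1)]
      have := sub_nonneg.2 ht.1
      have := ht.2
      gcongr
  rcases hα with hα | hα
  · refine ⟨_, natDegree_taylorSeqPoly_le (fun j => iteratedDerivWithin j u (Icc a α)) l n,
      fun t ht => ?_⟩
    have := abs_sub_eval_taylorSeqPoly_le (convex_Icc a α) (c := l) ⟨hl, hlr.trans hα⟩ n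
      (fun j => iteratedDerivWithin j u (Icc a α))
      (fun j hj t ht => hasDerivWithinAt_iteratedDerivWithin ha h.2.2.2.1 (by omega) ht)
      (fun t ht => h.abs_left_le ha hn ht) t ⟨hl.trans ht.1, ht.2.trans hα⟩
    rw [iteratedDerivWithin_zero] at this
    exact this.trans (hpow t ht)
  · refine ⟨_, natDegree_taylorSeqPoly_le (fun j => iteratedDerivWithin j u (Icc α b)) l n,
      fun t ht => ?_⟩
    have := abs_sub_eval_taylorSeqPoly_le (convex_Icc α b) (c := l) ⟨hα, hlr.trans hr⟩ n
      (fun j => iteratedDerivWithin j u (Icc α b))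
      (fun j hj t ht => hasDerivWithinAt_iteratedDerivWithin hb h.2.2.2.2.1 (by omega) ht)
      (fun t ht => h.abs_right_le hb hn ht) t ⟨hα.trans ht.1, ht.2.trans hr⟩
    rw [iteratedDerivWithin_zero] at this
    exact this.trans (hpow t ht)

end MemW

/-- A mesh `a = x 0 < ⋯ < x N = b` whose `k`-th element contains the interface point `α`. -/
structure IsMesh (N k : ℕ) (a b α : ℝ) (x : ℕ → ℝ) : Prop where
  one_le : 1 ≤ k
  le : k ≤ N
  zero : x 0 = a
  last : x N = b
  lt_succ : ∀ i, i < N → x i < x (i + 1)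
  left_lt : x (k - 1) < α
  lt_right : α < x k

namespace IsMesh

variable {N k : ℕ} {a b α : ℝ} {x : ℕ → ℝ}

theorem mono (h : IsMesh N k a b α x) {m n : ℕ} (hmn : m ≤ n) (hn : n ≤ N) : x m ≤ x n := by
  induction n, hmn using Nat.le_induction with
  | base => exact le_rfl
  | succ n _ ih => exact (ih (by omega)).trans (h.lt_succ n (by omega)).le

theorem le_node (h : IsMesh N k a b α x) {n : ℕ} (hn : n ≤ N) : a ≤ x n :=
  h.zero ▸ h.mono (Nat.zero_le n) hn

theorem node_le (h : IsMesh N k a b α x) {n : ℕ} (hn : n ≤ N) : x n ≤ b :=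
  h.last ▸ h.mono hn le_rfl

theorem lt (h : IsMesh N k a b α x) {i : ℕ} (hi : i ∈ Finset.Icc 1 N) : x (i - 1) < x i := by
  obtain ⟨h1, h2⟩ := Finset.mem_Icc.1 hi
  have := h.lt_succ (i - 1) (by omega)
  rwa [Nat.sub_add_cancel h1] at this

theorem lt_interface (h : IsMesh N k a b α x) : a < α :=
  (h.le_node (Nat.sub_le_of_le_add (by have := h.le; omega))).trans_lt h.left_lt

theorem interface_lt (h : IsMesh N k a b α x) : α < b :=
  h.lt_right.trans_le (h.node_le h.le)

theorem subset (h : IsMesh N k a b α x) {i : ℕ} (hi : i ∈ Finset.Icc 1 N) :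
    Icc (x (i - 1)) (x i) ⊆ Icc a b := by
  obtain ⟨h1, h2⟩ := Finset.mem_Icc.1 hi
  exact Icc_subset_Icc (h.le_node (by omega)) (h.node_le h2)

theorem le_or_le (h : IsMesh N k a b α x) {i : ℕ} (hi : i ∈ Finset.Icc 1 N) (hik : i ≠ k) :
    x i < α ∨ α < x (i - 1) := by
  obtain ⟨h1, h2⟩ := Finset.mem_Icc.1 hi
  have := h.le
  rcases lt_or_gt_of_ne hik with hik | hik
  · exact Or.inl ((h.mono (by omega) (by omega)).trans_lt h.left_lt)
  · exact Or.inr (h.lt_right.trans_le (h.mono (by omega) (by omega)))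

theorem exists_betaPW_eq (h : IsMesh N k a b α x) {βm βp : ℝ} (hβm : 0 < βm) (hβp : 0 < βp)
    {i : ℕ} (hi : i ∈ Finset.Icc 1 N) (hik : i ≠ k) :
    ∃ c, 0 < c ∧ ∀ t ∈ Icc (x (i - 1)) (x i), betaPW βm βp α t = c := by
  rcases h.le_or_le hi hik with hα | hα
  · exact ⟨βm, hβm, fun t ht => betaPW_of_lt (ht.2.trans_lt hα)⟩
  · exact ⟨βp, hβp, fun t ht => betaPW_of_le (hα.le.trans ht.1)⟩

theorem notMem_Ioo (h : IsMesh N k a b α x) {i : ℕ} (hi : i ∈ Finset.Icc 1 N) (hik : i ≠ k) :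
    α ∉ Ioo (x (i - 1)) (x i) := fun hα =>
  (h.le_or_le hi hik).elim (lt_asymm hα.2) (lt_asymm hα.1)

theorem exists_mem (h : IsMesh N k a b α x) {t : ℝ} (ht : t ∈ Icc a b) :
    ∃ i ∈ Finset.Icc 1 N, t ∈ Icc (x (i - 1)) (x i) := by
  have key : ∀ n, 1 ≤ n → n ≤ N → t ≤ x n → ∃ i ∈ Finset.Icc 1 N, t ∈ Icc (x (i - 1)) (x i) := by
    intro n hn
    induction n, hn using Nat.le_induction with
    | base => exact fun h1 h2 => ⟨1, Finset.mem_Icc.2 ⟨le_rfl, h1⟩, h.zero ▸ ht.1, h2⟩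
    | succ n _ ih =>
      intro h1 h2
      rcases le_total t (x n) with h3 | h3
      · exact ih (by omega) h3
      · exact ⟨n + 1, Finset.mem_Icc.2 ⟨by omega, h1⟩, h3, h2⟩
  exact key N (h.one_le.trans h.le) le_rfl (h.last.symm ▸ ht.2)

end IsMesh

/-- `f` restricts to an element of the local space `Sᵢ` on every mesh element. -/
def IsBrokenPoly (p N k : ℕ) (βm βp α : ℝ) (x : ℕ → ℝ) (f : ℝ → ℝ) : Prop :=
  (∀ i, 1 ≤ i → i ≤ N → i ≠ k → ∃ q : ℝ[X], q.natDegree ≤ p ∧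
    ∀ y ∈ Icc (x (i - 1)) (x i), f y = q.eval y) ∧
  ∃ qm qp : ℝ[X], qm.natDegree ≤ p ∧ qp.natDegree ≤ p ∧
    (∀ y ∈ Icc (x (k - 1)) α, f y = qm.eval y) ∧
    (∀ y ∈ Icc α (x k), f y = qp.eval y) ∧
    ∀ j, 1 ≤ j → j ≤ p →
      βm * (derivative^[j] qm).eval α = βp * (derivative^[j] qp).eval α

section BrokenPoly

variable {p N k : ℕ} {a b α βm βp : ℝ} {x : ℕ → ℝ} {f : ℝ → ℝ}

theorem IsBrokenPoly.exists_flux (hf : IsBrokenPoly p N k βm βp α x f)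
    (hx : IsMesh N k a b α x) (hp : 1 ≤ p) (hβm : 0 < βm) (hβp : 0 < βp) {i : ℕ}
    (hi : i ∈ Finset.Icc 1 N) :
    ∃ ψ : ℝ[X], ψ.natDegree ≤ p - 1 ∧
      HasFluxOn βm βp α f (fun t => ψ.eval t) (x (i - 1)) (x i) := by
  by_cases hik : i = k
  · subst hik
    exact exists_flux_of_interface hp hβm hβp hx.left_lt hx.lt_right hf.2
  · obtain ⟨c, hc, hβ⟩ := hx.exists_betaPW_eq hβm hβp hi hik
    obtain ⟨h1, h2⟩ := Finset.mem_Icc.1 hi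
    exact exists_flux_of_const hc hβ (hf.1 i h1 h2 hik)

theorem isBrokenPoly_of_eq_integral (hx : IsMesh N k a b α x) (hp : 1 ≤ p) (hβm : 0 < βm)
    (hβp : 0 < βp) {χ : ℕ → ℝ[X]} (hχ : ∀ i ∈ Finset.Icc 1 N, (χ i).natDegree ≤ p - 1)
    {K : ℕ → ℝ} (hf : ∀ i ∈ Finset.Icc 1 N, ∀ t ∈ Icc (x (i - 1)) (x i),
      f t = K i + ∫ s in (x (i - 1))..t, (χ i).eval s * (betaPW βm βp α s)⁻¹) :
    IsBrokenPoly p N k βm βp α x f := by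
  refine ⟨fun i h1 h2 hik => ?_, ?_⟩
  · have hi := Finset.mem_Icc.2 ⟨h1, h2⟩
    obtain ⟨c, -, hβ⟩ := hx.exists_betaPW_eq hβm hβp hi hik
    exact exists_polynomial_eq_integral_of_const hβ hp (hχ i hi) _ (hf i hi)
  · have hk := Finset.mem_Icc.2 ⟨hx.one_le, hx.le⟩
    exact exists_polynomial_eq_integral_of_interface hβm hβp hx.left_lt hp (hχ k hk) _ (hf k hk)
      hx.lt_right

theorem continuousAt_inv_betaPW {t : ℝ} (ht : t ≠ α) :
    ContinuousAt (fun s => (betaPW βm βp α s)⁻¹) t := by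
  rcases lt_or_gt_of_ne ht with ht | ht
  · refine (continuousAt_const (y := βm⁻¹)).congr ?_
    filter_upwards [Iio_mem_nhds ht] with s hs
    rw [betaPW_of_lt hs]
  · refine (continuousAt_const (y := βp⁻¹)).congr ?_
    filter_upwards [Ioi_mem_nhds ht] with s hs
    rw [betaPW_of_le (le_of_lt hs)]

theorem intervalIntegrable_eval_mul_inv_betaPW (hβm : 0 < βm) (hβp : 0 < βp) (χ : ℝ[X])
    (l r : ℝ) :
    IntervalIntegrable (fun s => χ.eval s * (betaPW βm βp α s)⁻¹) volume l r :=
  (intervalIntegrable_inv_betaPW hβm hβp α l r).continuousOn_mul χ.continuous.continuousOn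

theorem hasFluxOn_of_eq_integral (hβm : 0 < βm) (hβp : 0 < βp) {l r K : ℝ} {χ : ℝ[X]}
    (hc : ContinuousOn f (Icc l r))
    (hf : ∀ t ∈ Icc l r, f t = K + ∫ s in l..t, χ.eval s * (betaPW βm βp α s)⁻¹) :
    HasFluxOn βm βp α f (fun t => χ.eval t) l r := by
  refine ⟨hc, fun t ht hα => ?_⟩
  have h1 : f =ᶠ[nhds t] fun t => K + ∫ s in l..t, χ.eval s * (betaPW βm βp α s)⁻¹ := by
    filter_upwards [Icc_mem_nhds ht.1 ht.2] with y hy using hf y hy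
  refine ((intervalIntegral.integral_hasDerivAt_right
    (intervalIntegrable_eval_mul_inv_betaPW hβm hβp χ l t) ?_
    (χ.continuous.continuousAt.mul (continuousAt_inv_betaPW hα))).const_add
      K).congr_of_eventuallyEq h1
  exact (χ.continuous.measurable.mul
    (measurable_betaPW βm βp α).inv).stronglyMeasurable.stronglyMeasurableAtFilter

theorem IsMesh.exists_continuous_eq_integral (hx : IsMesh N k a b α x) (hβm : 0 < βm)
    (hβp : 0 < βp) (χ : ℕ → ℝ[X]) :
    ∃ f : ℝ → ℝ, Continuous f ∧ f a = 0 ∧ ∃ K : ℕ → ℝ,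
      ∀ i ∈ Finset.Icc 1 N, ∀ t ∈ Icc (x (i - 1)) (x i),
        f t = K i + ∫ s in (x (i - 1))..t, (χ i).eval s * (betaPW βm βp α s)⁻¹ := by
  have key : ∀ n ≤ N, ∃ f : ℝ → ℝ, Continuous f ∧ f a = 0 ∧ ∃ K : ℕ → ℝ,
      ∀ i ∈ Finset.Icc 1 n, ∀ t ∈ Icc (x (i - 1)) (x i),
        f t = K i + ∫ s in (x (i - 1))..t, (χ i).eval s * (betaPW βm βp α s)⁻¹ := by
    intro n
    induction n with
    | zero => exact fun _ => ⟨0, continuous_zero, rfl, 0, by simp⟩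
    | succ n ih =>
      intro hn
      obtain ⟨f, hfc, hfa, K, hfK⟩ := ih (by omega)
      have hprim := intervalIntegral.continuous_primitive (fun l r =>
        intervalIntegrable_eval_mul_inv_betaPW (α := α) hβm hβp (χ (n + 1)) l r) (x n)
      refine ⟨fun t => f (min t (x n)) + ∫ s in (x n)..(max t (x n)),
        (χ (n + 1)).eval s * (betaPW βm βp α s)⁻¹,
        (hfc.comp (by fun_prop)).add (hprim.comp (by fun_prop)), ?_,
        Function.update K (n + 1) (f (x n)), fun i hi t ht => ?_⟩
      · simp [hx.le_node (n := n) (by omega), hfa]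
      · obtain ⟨h1, h2⟩ := Finset.mem_Icc.1 hi
        rcases h2.eq_or_lt with rfl | h2
        · rw [Nat.add_sub_cancel] at ht ⊢
          simp [ht.1]
        · have : t ≤ x n := ht.2.trans (hx.mono (by omega) (by omega))
          rw [Function.update_of_ne h2.ne,
            ← hfK i (Finset.mem_Icc.2 ⟨h1, by omega⟩) t ht]
          simp [this]
  exact key N le_rfl

end BrokenPoly

namespace IsMesh

variable {N k : ℕ} {a b α : ℝ} {x : ℕ → ℝ} {f f' : ℝ → ℝ}

theorem eqOn_of_sub_eq_sub (hx : IsMesh N k a b α x) (h0 : f a = f' a)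
    (h : ∀ i ∈ Finset.Icc 1 N, ∀ t ∈ Icc (x (i - 1)) (x i),
      f t - f (x (i - 1)) = f' t - f' (x (i - 1))) : EqOn f f' (Icc a b) := by
  have node : ∀ n ≤ N, f (x n) = f' (x n) := by
    intro n
    induction n with
    | zero => exact fun _ => hx.zero.symm ▸ h0
    | succ n ih =>
      intro hn
      have hi : n + 1 ∈ Finset.Icc 1 N := Finset.mem_Icc.2 ⟨by omega, hn⟩
      have := h (n + 1) hi _ (right_mem_Icc.2 (hx.lt hi).le)
      rw [Nat.add_sub_cancel] at this
      linarith [ih (by omega)]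
  intro t ht
  obtain ⟨i, hi, hti⟩ := hx.exists_mem ht
  have := h i hi t hti
  obtain ⟨h1, h2⟩ := Finset.mem_Icc.1 hi
  linarith [node (i - 1) (by omega)]

theorem abs_le_of_abs_sub_le (hx : IsMesh N k a b α x) (h0 : f a = 0) {c E : ℝ} (hc : 0 ≤ c)
    (h : ∀ i ∈ Finset.Icc 1 N, ∀ t ∈ Icc (x (i - 1)) (x i), |f t - f (x (i - 1))| ≤ E)
    (hne : ∀ i ∈ Finset.Icc 1 N, i ≠ k → |f (x i) - f (x (i - 1))| ≤ c * (x i - x (i - 1)))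
    {t : ℝ} (ht : t ∈ Icc a b) : |f t| ≤ c * (b - a) + 2 * E := by
  have node : ∀ n ≤ N, |f (x n)| ≤ c * (x n - a) + if k ≤ n then E else 0 := by
    intro n
    induction n with
    | zero =>
      intro _
      have := hx.one_le
      rw [hx.zero, h0, if_neg (by omega)]
      simp
    | succ n ih =>
      intro hn
      have hi : n + 1 ∈ Finset.Icc 1 N := Finset.mem_Icc.2 ⟨by omega, hn⟩
      have ih := ih (by omega)
      have htri := abs_add_le (f (x (n + 1)) - f (x n)) (f (x n))
      rw [sub_add_cancel] at htri
      by_cases hk : n + 1 = k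
      · have h1 := h (n + 1) hi _ (right_mem_Icc.2 (hx.lt hi).le)
        rw [Nat.add_sub_cancel] at h1
        rw [if_neg (by omega)] at ih
        rw [if_pos (by omega)]
        have := mul_le_mul_of_nonneg_left (hx.lt_succ n (by omega)).le hc
        linarith
      · have h1 := hne (n + 1) hi hk
        rw [Nat.add_sub_cancel] at h1
        simp only [show k ≤ n + 1 ↔ k ≤ n by omega]
        linarith
  obtain ⟨i, hi, hti⟩ := hx.exists_mem ht
  obtain ⟨h1, h2⟩ := Finset.mem_Icc.1 hi
  have hE : 0 ≤ E := (abs_nonneg _).trans (h i hi t hti)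
  have hn := node (i - 1) (by omega)
  have hif : (if k ≤ i - 1 then E else 0) ≤ E := by split_ifs <;> simp [hE]
  have htri := abs_add_le (f t - f (x (i - 1))) (f (x (i - 1)))
  rw [sub_add_cancel] at htri
  have := mul_le_mul_of_nonneg_left (hx.node_le (n := i - 1) (by omega)) hc
  linarith [h i hi t hti]

end IsMesh

/-- The generalized Gauss rules, with weight `1/β`, on the elements of the mesh `x`. -/
structure IsGaussRule (p N : ℕ) (βm βp α : ℝ) (x : ℕ → ℝ) (g A : ℕ → ℕ → ℝ) : Prop where
  mem : ∀ i ∈ Finset.Icc 1 N, ∀ j ∈ Finset.Icc 1 p,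
    x (i - 1) < g i j ∧ g i j < x i ∧ g i j ≠ α
  lt_succ : ∀ i ∈ Finset.Icc 1 N, ∀ j, 1 ≤ j → j < p → g i j < g i (j + 1)
  pos : ∀ i ∈ Finset.Icc 1 N, ∀ j ∈ Finset.Icc 1 p, 0 < A i j
  quad : ∀ i ∈ Finset.Icc 1 N, ∀ F : ℝ[X], F.natDegree ≤ 2 * p - 1 →
    ∑ j ∈ Finset.Icc 1 p, A i j * F.eval (g i j)
      = ∫ t in (x (i - 1))..(x i), F.eval t / betaPW βm βp α t

/-- `v` is the Gauss–Lobatto projection of `u`. -/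
structure IsLobattoProjection (p N k : ℕ) (βm βp α : ℝ) (x : ℕ → ℝ) (u v : ℝ → ℝ) : Prop where
  broken : IsBrokenPoly p N k βm βp α x v
  interp : ∀ i, 1 ≤ i → i ≤ N → v (x (i - 1)) = u (x (i - 1)) ∧ v (x i) = u (x i)
  orth : ∀ i, 1 ≤ i → i ≤ N → i ≠ k → ∀ q : ℝ[X], q.natDegree ≤ p →
    ∫ t in (x (i - 1))..(x i),
      betaPW βm βp α t * (deriv u t - deriv v t) * (derivative q).eval t = 0
  orth_interface : ∀ qm qp : ℝ[X], qm.natDegree ≤ p → qp.natDegree ≤ p → qm.eval α = qp.eval α →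
    (∀ j, 1 ≤ j → j ≤ p →
      βm * (derivative^[j] qm).eval α = βp * (derivative^[j] qp).eval α) →
    (∫ t in (x (k - 1))..α,
        betaPW βm βp α t * (deriv u t - deriv v t) * (derivative qm).eval t)
      + (∫ t in α..(x k),
          betaPW βm βp α t * (deriv u t - deriv v t) * (derivative qp).eval t) = 0

section Corrector

variable {p N k : ℕ} {a b α βm βp γ : ℝ} {x : ℕ → ℝ} {g A : ℕ → ℕ → ℝ} {u v ω ω' : ℝ → ℝ}

theorem IsGaussRule.injOn (hg : IsGaussRule p N βm βp α x g A) {i : ℕ}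
    (hi : i ∈ Finset.Icc 1 N) : Set.InjOn (g i) (Finset.Icc 1 p : Finset ℕ) := by
  have hlt : ∀ m n, 1 ≤ m → m < n → n ≤ p → g i m < g i n := by
    intro m n hm hmn
    induction n, hmn using Nat.le_induction with
    | base => exact fun h => hg.lt_succ i hi m hm h
    | succ n hmn ih => exact fun h => (ih (by omega)).trans (hg.lt_succ i hi n (by omega) h)
  intro m hm n hn hmn
  rw [Finset.coe_Icc] at hm hn
  by_contra hne
  rcases lt_or_gt_of_ne hne with h | h
  · exact (hlt m n hm.1 h hn.2).ne hmn
  · exact (hlt n m hn.1 h hm.2).ne' hmn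

theorem IsGaussRule.eq_of_eval_eq (hg : IsGaussRule p N βm βp α x g A) (hp : 1 ≤ p) {i : ℕ}
    (hi : i ∈ Finset.Icc 1 N) {χ χ' : ℝ[X]} (hχ : χ.natDegree ≤ p - 1)
    (hχ' : χ'.natDegree ≤ p - 1)
    (h : ∀ j ∈ Finset.Icc 1 p, χ.eval (g i j) = χ'.eval (g i j)) : χ = χ' := by
  have hdeg : ∀ q : ℝ[X], q.natDegree ≤ p - 1 → q.degree < (Finset.Icc 1 p).card := fun q hq => by
    rw [Nat.card_Icc, Nat.add_sub_cancel]
    refine degree_le_natDegree.trans_lt ?_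
    exact_mod_cast (by omega : q.natDegree < p)
  exact Polynomial.eq_of_degrees_lt_of_eval_index_eq (v := g i) _ (hg.injOn hi) (hdeg χ hχ)
    (hdeg χ' hχ') h

theorem IsGaussRule.exists_eval_eq (hg : IsGaussRule p N βm βp α x g A) (r : ℕ → ℕ → ℝ) :
    ∃ χ : ℕ → ℝ[X], ∀ i ∈ Finset.Icc 1 N, (χ i).natDegree ≤ p - 1 ∧
      ∀ j ∈ Finset.Icc 1 p, (χ i).eval (g i j) = r i j := by
  refine ⟨fun i => Lagrange.interpolate (Finset.Icc 1 p) (g i) (r i), fun i hi => ⟨?_,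
    fun j hj => Lagrange.eval_interpolate_at_node _ (hg.injOn hi) hj⟩⟩
  have := Lagrange.degree_interpolate_le (r i) (hg.injOn hi)
  rw [Nat.card_Icc, Nat.add_sub_cancel] at this
  exact natDegree_le_of_degree_le (by exact_mod_cast this)

theorem OmegaProp.isBrokenPoly (hω : OmegaProp p N k a b α βm βp γ x g u v ω) :
    IsBrokenPoly p N k βm βp α x ω := ⟨hω.2.2.1, hω.2.2.2.1⟩

theorem OmegaProp.exists_flux (hω : OmegaProp p N k a b α βm βp γ x g u v ω)
    (hx : IsMesh N k a b α x) (hg : IsGaussRule p N βm βp α x g A) (hp : 1 ≤ p)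
    (hβm : 0 < βm) (hβp : 0 < βp) {i : ℕ} (hi : i ∈ Finset.Icc 1 N) :
    ∃ χ : ℝ[X], χ.natDegree ≤ p - 1 ∧
      (∀ t ∈ Icc (x (i - 1)) (x i),
        ∫ s in (x (i - 1))..t, χ.eval s * (betaPW βm βp α s)⁻¹ = ω t - ω (x (i - 1))) ∧
      ∀ j ∈ Finset.Icc 1 p, χ.eval (g i j)
        = betaPW βm βp α (g i j) * (deriv u (g i j) - deriv v (g i j))
          - γ * (u (g i j) - v (g i j)) := by
  obtain ⟨χ, hχ, hflux⟩ := hω.isBrokenPoly.exists_flux hx hp hβm hβp hi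
  refine ⟨χ, hχ, fun t ht => hflux.integral_eq hβm hβp χ.continuous.continuousOn ht,
    fun j hj => ?_⟩
  obtain ⟨h1, h2, h3⟩ := hg.mem i hi j hj
  rw [← hω.2.2.2.2 i hi j hj, hflux.betaPW_mul_deriv hβm hβp ⟨h1, h2⟩ h3]

theorem exists_omegaProp (hx : IsMesh N k a b α x) (hg : IsGaussRule p N βm βp α x g A)
    (hp : 1 ≤ p) (hβm : 0 < βm) (hβp : 0 < βp) (γ : ℝ) (u v : ℝ → ℝ) :
    ∃ ω, OmegaProp p N k a b α βm βp γ x g u v ω := by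
  obtain ⟨χ, hχ⟩ := hg.exists_eval_eq fun i j =>
    betaPW βm βp α (g i j) * (deriv u (g i j) - deriv v (g i j)) - γ * (u (g i j) - v (g i j))
  obtain ⟨ω, hωc, hωa, K, hωK⟩ := hx.exists_continuous_eq_integral hβm hβp χ
  have hbr := isBrokenPoly_of_eq_integral hx hp hβm hβp (fun i hi => (hχ i hi).1) hωK
  refine ⟨ω, hωc.continuousOn, hωa, hbr.1, hbr.2, fun i hi j hj => ?_⟩
  obtain ⟨h1, h2, h3⟩ := hg.mem i hi j hj
  rw [(hasFluxOn_of_eq_integral hβm hβp hωc.continuousOn (hωK i hi)).betaPW_mul_deriv hβm hβp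
    ⟨h1, h2⟩ h3, (hχ i hi).2 j hj]

theorem OmegaProp.eqOn (hω : OmegaProp p N k a b α βm βp γ x g u v ω)
    (hω' : OmegaProp p N k a b α βm βp γ x g u v ω') (hx : IsMesh N k a b α x)
    (hg : IsGaussRule p N βm βp α x g A) (hp : 1 ≤ p) (hβm : 0 < βm) (hβp : 0 < βp) :
    EqOn ω ω' (Icc a b) := by
  refine hx.eqOn_of_sub_eq_sub (by rw [hω.2.1, hω'.2.1]) fun i hi t ht => ?_
  obtain ⟨χ, hχ, hinteg, hev⟩ := hω.exists_flux hx hg hp hβm hβp hi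
  obtain ⟨χ', hχ', hinteg', hev'⟩ := hω'.exists_flux hx hg hp hβm hβp hi
  rw [← hinteg t ht, ← hinteg' t ht,
    hg.eq_of_eval_eq hp hi hχ hχ' fun j hj => by rw [hev j hj, hev' j hj]]

theorem IsLobattoProjection.isElementData (hv : IsLobattoProjection p N k βm βp α x u v)
    (hx : IsMesh N k a b α x) (hg : IsGaussRule p N βm βp α x g A)
    {m : ℕ} (hu : MemW m a b α βm βp u) (hm : 1 ≤ m)
    (hp : 1 ≤ p) (hβm : 0 < βm) (hβp : 0 < βp) {i : ℕ} (hi : i ∈ Finset.Icc 1 N) {ψ χ : ℝ[X]}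
    (hψ : ψ.natDegree ≤ p - 1)
    (hflux : HasFluxOn βm βp α v (fun t => ψ.eval t) (x (i - 1)) (x i))
    (hχ : χ.natDegree ≤ p - 1)
    (hev : ∀ j ∈ Finset.Icc 1 p, χ.eval (g i j)
      = betaPW βm βp α (g i j) * (deriv u (g i j) - deriv v (g i j))
        - γ * (u (g i j) - v (g i j))) :
    IsElementData p (x (i - 1)) (x i) γ (fun t => (betaPW βm βp α t)⁻¹)
      (fluxPW a b α βm βp u) (fun t => u t - v t) (g i) (A i) ψ χ := by
  have ha := hx.lt_interface
  have hb := hx.interface_lt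
  obtain ⟨h1, h2⟩ := Finset.mem_Icc.1 hi
  have hfluxu := hu.hasFluxOn hm ha hb hβm hβp (l := x (i - 1)) (r := x i)
    (hx.le_node (by omega)) (hx.node_le h2)
  have hΦ := (hu.continuousOn_fluxPW hm ha hb).mono (hx.subset hi)
  refine ⟨hp, hx.lt hi, intervalIntegrable_inv_betaPW hβm hβp α _ _,
    fun t => inv_pos.2 (betaPW_pos hβm hβp α t),
    fun j hj => ⟨(hg.mem i hi j hj).1.le, (hg.mem i hi j hj).2.1.le⟩, hg.pos i hi,
    fun F hF => ?_, hΦ, hψ, hχ, fun q hq => ?_, (hfluxu.sub hflux).1, fun t ht => ?_,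
    fun j hj => ?_⟩
  · simp only [hg.quad i hi F hF, div_eq_mul_inv]
  · by_cases hik : i = k
    · subst hik
      exact orthogonal_of_interface hβm hβp hx.left_lt hx.lt_right hp hΦ hfluxu hflux
        hv.orth_interface q hq
    · obtain ⟨c, -, hβ⟩ := hx.exists_betaPW_eq hβm hβp hi hik
      exact orthogonal_of_const hβm hβp (hx.lt hi).le hp hβ (hx.notMem_Ioo hi hik) hfluxu hflux
        (hv.orth i h1 h2 hik) q hq
  · rw [(hfluxu.sub hflux).integral_eq hβm hβp (hΦ.sub ψ.continuous.continuousOn) ht,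
      (hv.interp i h1 h2).1, sub_self, sub_zero]
  · obtain ⟨h3, h4, h5⟩ := hg.mem i hi j hj
    rw [hev j hj, hfluxu.betaPW_mul_deriv_sub_deriv hβm hβp hflux ⟨h3, h4⟩ h5]

end Corrector

section Estimates

variable {p N k : ℕ} {a b α βm βp γ : ℝ} {x : ℕ → ℝ} {g A : ℕ → ℕ → ℝ} {u v ω : ℝ → ℝ}
  {i : ℕ} {ψ χ : ℝ[X]}

theorem IsElementData.integral_abs_corr_le_pow {g A : ℕ → ℝ}
    (H : IsElementData p (x (i - 1)) (x i) γ (fun t => (betaPW βm βp α t)⁻¹)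
      (fluxPW a b α βm βp u) (fun t => u t - v t) g A ψ χ)
    (hx : IsMesh N k a b α x) (hu : MemW (2 * p + 1) a b α βm βp u)
    (hβm : 0 < βm) (hβp : 0 < βp) (hi : i ∈ Finset.Icc 1 N) :
    ∫ t in (x (i - 1))..(x i), |χ.eval t| * (betaPW βm βp α t)⁻¹
      ≤ (βm⁻¹ + βp⁻¹) * (βm + βp) * (2 + |γ| * (βm⁻¹ + βp⁻¹))
        * wnorm (2 * p + 1) a b α u * (x i - x (i - 1)) ^ (p + 2) := by
  have ha := hx.lt_interface
  have hb := hx.interface_lt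
  have hp := H.one_le
  obtain ⟨h1, h2⟩ := Finset.mem_Icc.1 hi
  have hl := hx.le_node (n := i - 1) (by omega)
  have hr := hx.node_le h2
  have hI := integral_inv_betaPW_le hβm hβp α H.lt.le
  have hh := sub_pos.2 H.lt
  have hM := hu.wnorm_nonneg ha
  obtain ⟨T, hT, hΦT⟩ := hu.exists_polynomial_fluxPW_approx ha hb hβm hβp hl H.lt.le hr
    (n := p) (by omega)
  obtain ⟨T', hT', hΦT'⟩ := hu.exists_polynomial_fluxPW_approx ha hb hβm hβp hl H.lt.le hr
    (n := p + 1) (by omega)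
  set h := x i - x (i - 1)
  set W := βm⁻¹ + βp⁻¹ with hWdef
  have hW : 0 < W := by positivity
  set M := wnorm (2 * p + 1) a b α u
  have he : ∀ t ∈ Icc (x (i - 1)) (x i), |u t - v t| ≤ W * h * ((βm + βp) * M * h ^ p) :=
    fun t ht => (H.abs_err_le hT hΦT t ht).trans
      (mul_le_mul_of_nonneg_right hI (by positivity))
  refine (H.integral_abs_corr_le (hT'.trans (by omega)) hΦT' he).trans
    ((mul_le_mul_of_nonneg_right hI (by positivity)).trans_eq ?_)
  ring

theorem IsElementData.abs_integral_corr_le_pow {g A : ℕ → ℝ}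
    (H : IsElementData p (x (i - 1)) (x i) γ (fun t => (betaPW βm βp α t)⁻¹)
      (fluxPW a b α βm βp u) (fun t => u t - v t) g A ψ χ)
    (hx : IsMesh N k a b α x) (hu : MemW (2 * p + 1) a b α βm βp u)
    (hv : IsLobattoProjection p N k βm βp α x u v)
    (hflux : HasFluxOn βm βp α v (fun t => ψ.eval t) (x (i - 1)) (x i))
    (hp : 2 ≤ p) (hβm : 0 < βm) (hβp : 0 < βp) (hi : i ∈ Finset.Icc 1 N) (hik : i ≠ k) :
    |∫ t in (x (i - 1))..(x i), χ.eval t * (betaPW βm βp α t)⁻¹|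
      ≤ 2 * (βm⁻¹ + βp⁻¹) * (βm + βp + |γ|)
        * wnorm (2 * p + 1) a b α u * (x i - x (i - 1)) ^ (2 * p + 1) := by
  have ha := hx.lt_interface
  have hb := hx.interface_lt
  obtain ⟨h1, h2⟩ := Finset.mem_Icc.1 hi
  have hl := hx.le_node (n := i - 1) (by omega)
  have hr := hx.node_le h2
  have hI := integral_inv_betaPW_le hβm hβp α H.lt.le
  have hh := sub_pos.2 H.lt
  have hM := hu.wnorm_nonneg ha
  obtain ⟨c, -, hβ⟩ := hx.exists_betaPW_eq hβm hβp hi hik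
  have hez := H.integral_err_eq_zero hp (c := c⁻¹) (fun t ht => by rw [hβ t ht])
    (sub_eq_zero.2 (hv.interp i h1 h2).2.symm) fun t ht =>
      ((hu.hasFluxOn (by omega) ha hb hβm hβp hl hr).sub hflux).2 t ht
        fun h => hx.notMem_Ioo hi hik (h ▸ ht)
  obtain ⟨T, hT, hΦT⟩ := hu.exists_polynomial_fluxPW_approx ha hb hβm hβp hl H.lt.le hr
    (n := 2 * p) le_rfl
  obtain ⟨S, hS, huS⟩ := hu.exists_polynomial_approx ha hb hl H.lt.le hr
    ((hx.le_or_le hi hik).imp le_of_lt le_of_lt) (n := 2 * p) (by omega)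
  obtain ⟨q, hq, hvq⟩ := hv.broken.1 i h1 h2 hik
  have heT : ∀ t ∈ Icc (x (i - 1)) (x i), |u t - v t - (S - q).eval t|
      ≤ wnorm (2 * p + 1) a b α u * (x i - x (i - 1)) ^ (2 * p) := fun t ht => by
    rw [hvq t ht, eval_sub, sub_sub_sub_cancel_right]
    exact huS t ht
  refine (H.abs_integral_corr_le hT hΦT
    ((natDegree_sub_le _ _).trans (max_le hS (hq.trans (by omega)))) heT hez).trans
    ((mul_le_mul_of_nonneg_left hI (by positivity)).trans_eq ?_)
  ring

theorem OmegaProp.abs_le (hω : OmegaProp p N k a b α βm βp γ x g u v ω)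
    (hx : IsMesh N k a b α x) (hg : IsGaussRule p N βm βp α x g A)
    (hv : IsLobattoProjection p N k βm βp α x u v) (hu : MemW (2 * p + 1) a b α βm βp u)
    (hp : 2 ≤ p) (hβm : 0 < βm) (hβp : 0 < βp) {hm : ℝ}
    (hhm : ∀ i ∈ Finset.Icc 1 N, x i - x (i - 1) ≤ hm) {t : ℝ} (ht : t ∈ Icc a b) :
    |ω t| ≤ 2 * (βm⁻¹ + βp⁻¹) * ((βm + βp) * (2 + |γ| * (βm⁻¹ + βp⁻¹))
      + (βm + βp + |γ|) * (b - a) ^ (p - 1)) * hm ^ (p + 2)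
      * wnorm (2 * p + 1) a b α u := by
  have hM := hu.wnorm_nonneg hx.lt_interface
  have hd : 0 < b - a := sub_pos.2 (hx.lt_interface.trans hx.interface_lt)
  have hk : k ∈ Finset.Icc 1 N := Finset.mem_Icc.2 ⟨hx.one_le, hx.le⟩
  have hm0 : 0 < hm := (sub_pos.2 (hx.lt hk)).trans_le (hhm k hk)
  have key := hx.abs_le_of_abs_sub_le hω.2.1
    (c := 2 * (βm⁻¹ + βp⁻¹) * (βm + βp + |γ|) * (b - a) ^ (p - 2) * hm ^ (p + 2)
      * wnorm (2 * p + 1) a b α u)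
    (E := (βm⁻¹ + βp⁻¹) * (βm + βp) * (2 + |γ| * (βm⁻¹ + βp⁻¹))
      * wnorm (2 * p + 1) a b α u * hm ^ (p + 2)) (by positivity)
    (fun i hi s hs => ?_) (fun i hi hik => ?_) ht
  · refine key.trans_eq ?_
    obtain ⟨n, rfl⟩ := Nat.exists_eq_add_of_le' hp
    simp only [Nat.add_sub_cancel, show n + 2 - 1 = n + 1 by omega]
    ring
  all_goals
    have hh := sub_pos.2 (hx.lt hi)
    have hhm := hhm i hi
    obtain ⟨χ, hχ, hinteg, hev⟩ := hω.exists_flux hx hg (by omega) hβm hβp hi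
    obtain ⟨ψ, hψ, hflux⟩ := hv.broken.exists_flux hx (by omega) hβm hβp hi
    have H := hv.isElementData hx hg hu (by omega) (by omega) hβm hβp hi hψ hflux hχ hev
  · rw [← hinteg s hs]
    refine (H.abs_integral_corr_le_of_mem hs).trans
      ((H.integral_abs_corr_le_pow hx hu hβm hβp hi).trans ?_)
    gcongr
  · rw [← hinteg _ (right_mem_Icc.2 H.lt.le)]
    refine (H.abs_integral_corr_le_pow hx hu hv hflux hp hβm hβp hi hik).trans ?_
    obtain ⟨h1, h2⟩ := Finset.mem_Icc.1 hi
    have hhd : x i - x (i - 1) ≤ b - a :=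
      sub_le_sub (hx.node_le h2) (hx.le_node (by omega))
    have hpow : (x i - x (i - 1)) ^ (2 * p + 1)
        ≤ (b - a) ^ (p - 2) * hm ^ (p + 2) * (x i - x (i - 1)) := by
      rw [show 2 * p + 1 = (p - 2) + (p + 2) + 1 by omega, pow_succ, pow_add]
      gcongr
    refine (mul_le_mul_of_nonneg_left hpow (by positivity)).trans_eq ?_
    ring

end Estimates

end

/-- for `p ≥ 2` and `u ∈ W̃_β^{2p+1,∞}`: (i) there is a unique `ω ∈ Ũ_T`
with `β ω′(g_{i,j}) = β (u − I_h u)′(g_{i,j}) − γ (u − I_h u)(g_{i,j})` at all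
generalized Gauss points; (ii) `sup_{[a,b]} |ω| ≤ C h^{p+2} ‖u‖_{2p+1,∞}`, where `C`
depends only on `p`, `β⁻`, `β⁺`, `γ` and `b−a`. -/
theorem stmt_14 (p : ℕ) (hp : 2 ≤ p) (βm βp γ d : ℝ)
    (hβm : 0 < βm) (hβp : 0 < βp) (hd : 0 < d) :
    ∃ C : ℝ, 0 < C ∧
    (∀ (N k : ℕ) (a b α hm : ℝ) (x : ℕ → ℝ) (g A : ℕ → ℕ → ℝ),
    b - a = d →
    1 ≤ N →
    1 ≤ k →
    k ≤ N →
    a < b →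
    x 0 = a →
    x N = b →
    (∀ i, i < N → x i < x (i + 1)) →
    x (k - 1) < α →
    α < x k →
    (∀ i ∈ Finset.Icc 1 N, ∀ j ∈ Finset.Icc 1 p,
      x (i - 1) < g i j ∧ g i j < x i ∧ g i j ≠ α) →
    (∀ i ∈ Finset.Icc 1 N, ∀ j, 1 ≤ j → j < p → g i j < g i (j + 1)) →
    (∀ i ∈ Finset.Icc 1 N, ∀ j ∈ Finset.Icc 1 p, 0 < A i j) →
    (∀ i ∈ Finset.Icc 1 N, ∀ F : Polynomial ℝ, F.natDegree ≤ 2 * p - 1 →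
      ∑ j ∈ Finset.Icc 1 p, A i j * F.eval (g i j)
        = ∫ t in (x (i - 1))..(x i), F.eval t / betaPW βm βp α t) →
    (∀ i ∈ Finset.Icc 1 N, x i - x (i - 1) ≤ hm) →
    ∀ u : ℝ → ℝ, MemW (2 * p + 1) a b α βm βp u →
    ∀ Ihu : ℝ → ℝ,
    ContinuousOn Ihu (Set.Icc a b) →
    (∀ i, 1 ≤ i → i ≤ N → i ≠ k → ∃ q : Polynomial ℝ, q.natDegree ≤ p ∧
      ∀ y ∈ Set.Icc (x (i - 1)) (x i), Ihu y = q.eval y) →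
    (∃ qm qp : Polynomial ℝ, qm.natDegree ≤ p ∧ qp.natDegree ≤ p ∧
      (∀ y ∈ Set.Icc (x (k - 1)) α, Ihu y = qm.eval y) ∧
      (∀ y ∈ Set.Icc α (x k), Ihu y = qp.eval y) ∧
      ∀ j, 1 ≤ j → j ≤ p →
        βm * ((⇑Polynomial.derivative)^[j] qm).eval α
          = βp * ((⇑Polynomial.derivative)^[j] qp).eval α) →
    (∀ i, 1 ≤ i → i ≤ N → Ihu (x (i - 1)) = u (x (i - 1)) ∧ Ihu (x i) = u (x i)) →
    (∀ i, 1 ≤ i → i ≤ N → i ≠ k → ∀ q : Polynomial ℝ, q.natDegree ≤ p →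
      ∫ t in (x (i - 1))..(x i),
        betaPW βm βp α t * (deriv u t - deriv Ihu t) * (Polynomial.derivative q).eval t = 0) →
    (∀ qm qp : Polynomial ℝ, qm.natDegree ≤ p → qp.natDegree ≤ p →
      qm.eval α = qp.eval α →
      (∀ j, 1 ≤ j → j ≤ p →
        βm * ((⇑Polynomial.derivative)^[j] qm).eval α
          = βp * ((⇑Polynomial.derivative)^[j] qp).eval α) →
      (∫ t in (x (k - 1))..α,
          betaPW βm βp α t * (deriv u t - deriv Ihu t) * (Polynomial.derivative qm).eval t)
        + (∫ t in α..(x k),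
            betaPW βm βp α t * (deriv u t - deriv Ihu t) * (Polynomial.derivative qp).eval t)
        = 0) →
    (∃ ω : ℝ → ℝ, OmegaProp p N k a b α βm βp γ x g u Ihu ω ∧
      ∀ ω' : ℝ → ℝ, OmegaProp p N k a b α βm βp γ x g u Ihu ω' →
        Set.EqOn ω' ω (Set.Icc a b)) ∧
    (∀ ω : ℝ → ℝ, OmegaProp p N k a b α βm βp γ x g u Ihu ω →
      ∀ t ∈ Set.Icc a b, |ω t| ≤ C * hm ^ (p + 2) * wnorm (2 * p + 1) a b α u)) := by
  refine ⟨2 * (βm⁻¹ + βp⁻¹) * ((βm + βp) * (2 + |γ| * (βm⁻¹ + βp⁻¹))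
    + (βm + βp + |γ|) * d ^ (p - 1)), by positivity, ?_⟩
  rintro N k a b α hm x g A rfl hN hk hkN hab hx0 hxN hxlt hxl hxr hgm hglt hA hquad hhm u hu
    v - hv1 hv2 hv3 hv4 hv5
  have hx : IsMesh N k a b α x := ⟨hk, hkN, hx0, hxN, hxlt, hxl, hxr⟩
  have hg : IsGaussRule p N βm βp α x g A := ⟨hgm, hglt, hA, hquad⟩
  have hv : IsLobattoProjection p N k βm βp α x u v := ⟨⟨hv1, hv2⟩, hv3, hv4, hv5⟩
  have hp1 : 1 ≤ p := by omega
  obtain ⟨ω, hω⟩ := exists_omegaProp hx hg hp1 hβm hβp γ u v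
  exact ⟨⟨ω, hω, fun ω' hω' => hω'.eqOn hω hx hg hp1 hβm hβp⟩,
    fun ω' hω' t ht => hω'.abs_le hx hg hv hu hp hβm hβp hhm ht⟩
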